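/- arXiv:2303.11768 — 4 statements merged into one kernel-verified Lean document; each statement's English description precedes it below -/
import Mathlib

section
/- Let X be a Hausdorff space, let 𝒜 be an ideal of closed sets of X consisting of compact sets, let 𝔸(X) denote 𝒜 regarded as a subspace of 𝕂(X), and let ℬ be an ideal of closed sets of 𝔸(X) consisting of compact sets. For U open in X write [U] = {K ∈ 𝔸(X) : K ⊆ U}. Assume hypotheses (S1)–(S5): (S1) for every K₀ ∈ 𝒜 the set {K ∈ 𝔸(X) : K ⊆ K₀} belongs to ℬ, and for every 𝐊 ∈ ℬ the union ⋃𝐊 belongs to 𝒜; (S2) for every 𝒜-cover 𝒰 of X, {[U] : U ∈ 𝒰} is a ℬ-cover of 𝔸(X); (S3) for every ℬ-cover 𝒰 of 𝔸(X), the family {V : V a nonempty proper open subset of X with [V] ⊆ U for some U ∈ 𝒰} is an 𝒜-cover of X; (S4) if X satisfies S_fin(𝒪_X(𝒜), 𝒪_X(𝒜)^gp) then X has the Hurewicz property, and likewise for 𝔸(X) with ℬ; (S5) 𝔸(X) is Menger iff 𝔸(X) satisfies S_fin(𝒪_{𝔸(X)}(ℬ), 𝒪_{𝔸(X)}(ℬ))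 iff X satisfies S_fin(𝒪_X(𝒜), 𝒪_X(𝒜)). Assume moreover the following are equivalent: 𝔸(X) is Rothberger; 𝔸(X) satisfies S_1(𝒪_{𝔸(X)}(ℬ), 𝒪_{𝔸(X)}(ℬ)); X satisfies S_1(𝒪_X(𝒜), 𝒪_X(𝒜)). Then the following are equivalent: (i) 𝔸(X) is Gerlits-Nagy; (ii) 𝔸(X) satisfies S_1(𝒪_{𝔸(X)}(ℬ), 𝒪_{𝔸(X)}(ℬ)^gp); (iii) X satisfies S_1(𝒪_X(𝒜), 𝒪_X(𝒜)^gp). -/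
open Set TopologicalSpace

universe u

/-- A non-trivial open cover: a family of nonempty proper open sets covering `X`. -/
def NTOpenCover (X : Type u) [TopologicalSpace X] (𝒰 : Set (Set X)) : Prop :=
  (∀ U ∈ 𝒰, IsOpen U ∧ U.Nonempty ∧ U ≠ Set.univ) ∧ ⋃₀ 𝒰 = Set.univ

/-- `𝒪_X`, the collection of non-trivial open covers of `X`. -/
def OX (X : Type u) [TopologicalSpace X] : Set (Set (Set X)) := {𝒰 | NTOpenCover X 𝒰}

/-- The Hurewicz property. -/
def HurewiczProp (X : Type u) [TopologicalSpace X] : Prop :=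
  ∀ 𝒰 : ℕ → Set (Set X), (∀ n, 𝒰 n ∈ OX X) →
    ∃ ℱ : ℕ → Set (Set X), (∀ n, ℱ n ⊆ 𝒰 n ∧ (ℱ n).Finite) ∧
      ∀ x : X, ∃ m : ℕ, ∀ n ≥ m, x ∈ ⋃₀ ℱ n

/-- The selection principle `S_fin(𝒜, ℬ)`. -/
def Sfin {α : Type u} (𝒜 ℬ : Set (Set α)) : Prop :=
  ∀ 𝒰 : ℕ → Set α, (∀ n, 𝒰 n ∈ 𝒜) →
    ∃ ℱ : ℕ → Set α, (∀ n, ℱ n ⊆ 𝒰 n ∧ (ℱ n).Finite) ∧ (⋃ n, ℱ n) ∈ ℬ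

/-- The selection principle `S_1(𝒜, ℬ)`. -/
def Sone {α : Type u} (𝒜 ℬ : Set (Set α)) : Prop :=
  ∀ 𝒰 : ℕ → Set α, (∀ n, 𝒰 n ∈ 𝒜) →
    ∃ f : ℕ → α, (∀ n, f n ∈ 𝒰 n) ∧ Set.range f ∈ ℬ

/-- A member `C` of a collection `ℭ` is groupable if there is a finite-to-one map
`φ : C → ℕ` such that for every infinite `J ⊆ ℕ`, `⋃ {φ⁻¹(n) : n ∈ J} ∈ ℭ`. -/
def Groupable {α : Type u} (ℭ : Set (Set α)) (C : Set α) : Prop :=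
  ∃ φ : α → ℕ, (∀ n : ℕ, {x ∈ C | φ x = n}.Finite) ∧
    ∀ J : Set ℕ, J.Infinite → {x ∈ C | φ x ∈ J} ∈ ℭ

/-- `ℭ^gp`, the collection of groupable members of `ℭ`. -/
def groupables {α : Type u} (ℭ : Set (Set α)) : Set (Set α) :=
  {C | C ∈ ℭ ∧ Groupable ℭ C}

/-- The Menger property. -/
def MengerProp (X : Type u) [TopologicalSpace X] : Prop := Sfin (OX X) (OX X)

/-- The Rothberger property. -/
def RothbergerProp (X : Type u) [TopologicalSpace X] : Prop := Sone (OX X) (OX X)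

/-- The Gerlits-Nagy property: Hurewicz and Rothberger. -/
def GerlitsNagyProp (X : Type u) [TopologicalSpace X] : Prop :=
  HurewiczProp X ∧ RothbergerProp X

/-- `𝒪_X(𝒜)`, the collection of `𝒜`-covers of `X`. -/
def ACovers (X : Type u) [TopologicalSpace X] (𝒜 : Set (Set X)) : Set (Set (Set X)) :=
  {𝒰 | 𝒰 ∈ OX X ∧ ∀ A ∈ 𝒜, ∃ U ∈ 𝒰, A ⊆ U}

/-- `𝒦_X`, the collection of `k`-covers of `X`. -/
def KCovers (X : Type u) [TopologicalSpace X] : Set (Set (Set X)) :=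
  {𝒰 | 𝒰 ∈ OX X ∧ ∀ K : Set X, IsCompact K → K.Nonempty → ∃ U ∈ 𝒰, K ⊆ U}

/-- `Ω_X`, the collection of `ω`-covers of `X`. -/
def OmegaCovers (X : Type u) [TopologicalSpace X] : Set (Set (Set X)) :=
  {𝒰 | 𝒰 ∈ OX X ∧ ∀ F : Set X, F.Finite → F.Nonempty → ∃ U ∈ 𝒰, F ⊆ U}

/-- An ideal of closed sets of `X`. -/
def IdealOfClosedSets (X : Type u) [TopologicalSpace X] (𝒜 : Set (Set X)) : Prop :=
  (∀ A ∈ 𝒜, IsClosed A ∧ A.Nonempty ∧ A ≠ Set.univ) ∧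
  (∀ F : Set X, F.Finite → F.Nonempty → F ∈ 𝒜) ∧
  (∀ A B : Set X, A ∈ 𝒜 → B ∈ 𝒜 → A ∪ B ≠ Set.univ → A ∪ B ∈ 𝒜) ∧
  (∀ A ∈ 𝒜, ∀ B : Set X, B ⊆ A → IsClosed B → B.Nonempty → B ∈ 𝒜)

/-- One has a winning strategy in the Hurewicz game on `X`. -/
def OneWinsHurewicz (X : Type u) [TopologicalSpace X] : Prop :=
  ∃ σ : List (Set (Set X)) → Set (Set X), (∀ s, σ s ∈ OX X) ∧
    ∀ F : ℕ → Set (Set X),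
      (∀ n, (F n).Finite ∧ F n ⊆ σ (List.ofFn fun i : Fin n => F i)) →
        ∃ x : X, ∀ m : ℕ, ∃ n ≥ m, x ∉ ⋃₀ F n

/-- One has a winning strategy in `G_fin(𝒜, ℬ)`. -/
def OneWinsGfin {α : Type u} (𝒜 ℬ : Set (Set α)) : Prop :=
  ∃ σ : List (Set α) → Set α, (∀ s, σ s ∈ 𝒜) ∧
    ∀ F : ℕ → Set α,
      (∀ n, (F n).Finite ∧ F n ⊆ σ (List.ofFn fun i : Fin n => F i)) →
        (⋃ n, F n) ∉ ℬ

/-- One has a winning predetermined strategy in `G_fin(𝒜, ℬ)`. -/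
def OneWinsPreGfin {α : Type u} (𝒜 ℬ : Set (Set α)) : Prop :=
  ∃ σ : ℕ → Set α, (∀ n, σ n ∈ 𝒜) ∧
    ∀ F : ℕ → Set α, (∀ n, (F n).Finite ∧ F n ⊆ σ n) → (⋃ n, F n) ∉ ℬ

/-- One has a winning strategy in `G_1(𝒜, ℬ)`. -/
def OneWinsGone {α : Type u} (𝒜 ℬ : Set (Set α)) : Prop :=
  ∃ σ : List α → Set α, (∀ s, σ s ∈ 𝒜) ∧
    ∀ f : ℕ → α, (∀ n, f n ∈ σ (List.ofFn fun i : Fin n => f i)) → Set.range f ∉ ℬ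

/-- One has a winning predetermined strategy in `G_1(𝒜, ℬ)`. -/
def OneWinsPreGone {α : Type u} (𝒜 ℬ : Set (Set α)) : Prop :=
  ∃ σ : ℕ → Set α, (∀ n, σ n ∈ 𝒜) ∧
    ∀ f : ℕ → α, (∀ n, f n ∈ σ n) → Set.range f ∉ ℬ

/-- The collection `𝒜` of subsets of `X`, viewed as a hyperspace with the Vietoris topology. -/
def Hyper (X : Type u) (𝒜 : Set (Set X)) : Type u := {K : Set X // K ∈ 𝒜}

/-- The Vietoris topology on `Hyper X 𝒜`. -/
instance Hyper.topologicalSpace (X : Type u) [TopologicalSpace X] (𝒜 : Set (Set X)) :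
    TopologicalSpace (Hyper X 𝒜) :=
  TopologicalSpace.generateFrom
    {S | ∃ U : Set X, IsOpen U ∧
      (S = {K : Hyper X 𝒜 | K.1 ⊆ U} ∨ S = {K : Hyper X 𝒜 | (K.1 ∩ U).Nonempty})}

/-- `𝕂(X)`: the nonempty compact subsets of `X` with the Vietoris topology. -/
abbrev HyperK (X : Type u) [TopologicalSpace X] : Type u :=
  Hyper X {K : Set X | IsCompact K ∧ K.Nonempty}

/-- `𝒫_fin(X)`: the nonempty finite subsets of `X` with the Vietoris topology. -/
abbrev PFin (X : Type u) : Type u :=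
  Hyper X {F : Set X | F.Finite ∧ F.Nonempty}

/-- `C_p(X)`: continuous real-valued functions with the topology of pointwise convergence
(the subspace topology from the product topology on `X → ℝ`). -/
abbrev Cp (X : Type u) [TopologicalSpace X] : Type u := {f : X → ℝ // Continuous f}

/-- `C_k(X)`: continuous real-valued functions with the compact-open topology. -/
def Ck (X : Type u) [TopologicalSpace X] : Type u := {f : X → ℝ // Continuous f}

instance Ck.topologicalSpace (X : Type u) [TopologicalSpace X] : TopologicalSpace (Ck X) :=
  TopologicalSpace.generateFrom
    {S | ∃ (K : Set X) (U : Set ℝ), IsCompact K ∧ IsOpen U ∧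
      S = {f : Ck X | ∀ x ∈ K, f.1 x ∈ U}}

/-- The constantly zero function in `C_p(X)`. -/
def zeroCp (X : Type u) [TopologicalSpace X] : Cp X := ⟨fun _ => (0 : ℝ), continuous_const⟩

/-- The constantly zero function in `C_k(X)`. -/
def zeroCk (X : Type u) [TopologicalSpace X] : Ck X := ⟨fun _ => (0 : ℝ), continuous_const⟩

/-- `Ω_{Y,y}`: the sets having `y` in their closure but not containing `y`. -/
def OmegaPt (Y : Type u) [TopologicalSpace Y] (y : Y) : Set (Set Y) :=
  {A | y ∈ closure A ∧ y ∉ A}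

/-- Countable fan-tightness. -/
def CountableFanTightness (Y : Type u) [TopologicalSpace Y] : Prop :=
  ∀ y : Y, Sfin (OmegaPt Y y) (OmegaPt Y y)

/-- Countable strong fan-tightness. -/
def CountableStrongFanTightness (Y : Type u) [TopologicalSpace Y] : Prop :=
  ∀ y : Y, Sone (OmegaPt Y y) (OmegaPt Y y)

/-- The Reznichenko property: every countable member of `Ω_{Y,y}` is groupable. -/
def Reznichenko (Y : Type u) [TopologicalSpace Y] : Prop :=
  ∀ y : Y, ∀ A ∈ OmegaPt Y y, A.Countable → Groupable (OmegaPt Y y) A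


theorem sone_of_gp {α : Type u} {ℭ : Set (Set α)} (h : Sone ℭ (groupables ℭ)) : Sone ℭ ℭ := by
  intro 𝒰 h𝒰
  obtain ⟨f, hf, hr⟩ := h 𝒰 h𝒰
  exact ⟨f, hf, hr.1⟩

theorem sfin_of_sone {α : Type u} {𝒞 ℭ : Set (Set α)} (h : Sone 𝒞 ℭ) : Sfin 𝒞 ℭ := by
  intro 𝒰 h𝒰
  obtain ⟨f, hf, hr⟩ := h 𝒰 h𝒰
  refine ⟨fun n => {f n}, fun n => ⟨by simpa using hf n, Set.finite_singleton _⟩, ?_⟩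
  have : (⋃ n, ({f n} : Set α)) = Set.range f := by ext x; simp [eq_comm]
  rw [this]; exact hr

theorem acovers_diff {Z : Type u} [TopologicalSpace Z] {𝒞 : Set (Set Z)}
    (hC : ∀ F : Set Z, F.Finite → F.Nonempty → F ∈ 𝒞)
    (hne : ∀ A ∈ 𝒞, A.Nonempty) (hfin : ∀ A ∈ 𝒞, A.Finite) {𝒰 : Set (Set Z)}
    (h : 𝒰 ∈ ACovers Z 𝒞) {F : Set (Set Z)} (hF : F.Finite) : 𝒰 \ F ∈ ACovers Z 𝒞 := by
  have key : ∀ A ∈ 𝒞, ∃ U ∈ 𝒰 \ F, A ⊆ U := by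
    intro A hA
    have h1 : ∀ U : Set Z, ∃ E : Set Z, E.Finite ∧ (U ∈ 𝒰 → ¬ E ⊆ U) := by
      intro U
      by_cases hU : U ∈ 𝒰
      · have := (h.1.1 U hU).2.2
        rw [Set.ne_univ_iff_exists_notMem] at this
        obtain ⟨x, hx⟩ := this
        exact ⟨{x}, Set.finite_singleton _, fun _ => by simpa using hx⟩
      · exact ⟨∅, Set.finite_empty, fun h => absurd h hU⟩
    choose E hE hE' using h1
    have h2 : (A ∪ ⋃ U ∈ F, E U).Finite :=
      (hfin A hA).union (hF.biUnion fun U _ => hE U)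
    obtain ⟨U, hU, hs⟩ := h.2 _ (hC _ h2 ((hne A hA).mono Set.subset_union_left))
    refine ⟨U, ⟨hU, fun hUF => hE' U hU ?_⟩, Set.subset_union_left.trans hs⟩
    exact (Set.subset_biUnion_of_mem (u := E) hUF).trans (Set.subset_union_right.trans hs)
  refine ⟨⟨fun U hU => h.1.1 U hU.1, ?_⟩, key⟩
  ext x
  simp only [Set.mem_univ, iff_true]
  obtain ⟨U, hU, hs⟩ := key {x} (hC _ (Set.finite_singleton _) (Set.singleton_nonempty _))
  exact ⟨U, hU, by simpa using hs⟩

/-- Abstract step: `S_1(𝒞,𝒞)` plus a Hurewicz-type selection give `S_1(𝒞,𝒞^gp)`. -/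
theorem sone_gp {Z : Type u} [TopologicalSpace Z] {𝒞 : Set (Set Z)}
    (hC : ∀ F : Set Z, F.Finite → F.Nonempty → F ∈ 𝒞)
    (hne : ∀ A ∈ 𝒞, A.Nonempty) (hfin : ∀ A ∈ 𝒞, A.Finite)
    (hS : Sone (ACovers Z 𝒞) (ACovers Z 𝒞))
    (hH : ∀ 𝒰 : ℕ → Set (Set Z), (∀ n, 𝒰 n ∈ ACovers Z 𝒞) →
      ∃ ℱ : ℕ → Set (Set Z), (∀ n, ℱ n ⊆ 𝒰 n ∧ (ℱ n).Finite) ∧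
        ∀ A ∈ 𝒞, ∃ m : ℕ, ∀ n ≥ m, ∃ U ∈ ℱ n, A ⊆ U) :
    Sone (ACovers Z 𝒞) (groupables (ACovers Z 𝒞)) := by
  classical
  intro 𝒰 h𝒰
  obtain ⟨f, hf, hr⟩ := hS 𝒰 h𝒰
  refine ⟨f, hf, hr, ?_⟩
  obtain ⟨ℱ, hℱ, hA⟩ := hH (fun n => Set.range f \ (f '' Set.Iio n))
    (fun n => acovers_diff hC hne hfin hr ((Set.finite_Iio n).image f))
  -- index function
  have hι : ∀ U : Set Z, ∃ k : ℕ, U ∈ Set.range f → (f k = U ∧ ∀ m < k, f m ≠ U) := by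
    intro U
    by_cases hU : ∃ k, f k = U
    · exact ⟨Nat.find hU, fun _ => ⟨Nat.find_spec hU, fun m hm => Nat.find_min hU hm⟩⟩
    · exact ⟨0, fun h => absurd h hU⟩
  choose ι hι using hι
  have hlow : ∀ n, ∀ U ∈ ℱ n, n ≤ ι U := by
    intro n U hU
    have h1 := (hℱ n).1 hU
    by_contra hlt
    exact h1.2 ⟨ι U, not_le.1 hlt, (hι U h1.1).1⟩
  have hb : ∀ n, ∃ b, n < b ∧ ∀ U ∈ ℱ n, ι U < b := by
    intro n
    obtain ⟨b, hb⟩ := ((hℱ n).2.image ι).bddAbove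
    refine ⟨max (n+1) (b+1), by omega, fun U hU => ?_⟩
    have := hb ⟨U, hU, rfl⟩
    omega
  choose g hg hg' using hb
  let s : ℕ → ℕ := fun j => g^[j] 0
  have hs0 : s 0 = 0 := rfl
  have hss : ∀ j, s (j+1) = g (s j) := fun j => Function.iterate_succ_apply' g j 0
  have hsm : StrictMono s := strictMono_nat_of_lt_succ fun j => by rw [hss]; exact hg _
  have hex : ∀ k, ∃ j, s j ≤ k ∧ k < s (j+1) := by
    intro k
    have hx : ∃ j, k < s (j+1) := ⟨k, lt_of_lt_of_le (Nat.lt_succ_self k) (hsm.id_le (k+1))⟩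
    refine ⟨Nat.find hx, ?_, Nat.find_spec hx⟩
    rcases h : Nat.find hx with _ | j
    · rw [hs0]; exact Nat.zero_le _
    · exact not_lt.1 (Nat.find_min hx (m := j) (by omega))
  choose p hp1 hp2 using hex
  have huniq : ∀ k j, s j ≤ k → k < s (j+1) → p k = j := by
    intro k j h1 h2
    have a := hsm.lt_iff_lt.1 (lt_of_le_of_lt h1 (hp2 k))
    have b := hsm.lt_iff_lt.1 (lt_of_le_of_lt (hp1 k) h2)
    omega
  refine ⟨fun U => p (ι U), ?_, ?_⟩
  · intro n
    refine ((Set.finite_Iio (s (n+1))).image f).subset ?_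
    rintro U ⟨hU, hn⟩
    refine ⟨ι U, ?_, (hι U hU).1⟩
    have := hp2 (ι U)
    simp only at hn
    rw [hn] at this
    exact this
  · intro J hJ
    have key : ∀ A ∈ 𝒞, ∃ U ∈ {x ∈ Set.range f | p (ι x) ∈ J}, A ⊆ U := by
      intro A hAC
      obtain ⟨m, hm⟩ := hA A hAC
      obtain ⟨j, hjJ, hj⟩ := hJ.exists_gt m
      obtain ⟨U, hU, hAU⟩ := hm (s j) (hj.le.trans (hsm.id_le j))
      refine ⟨U, ⟨((hℱ _).1 hU).1, ?_⟩, hAU⟩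
      rw [huniq (ι U) j (hlow _ U hU) (by rw [hss]; exact hg' _ U hU)]
      exact hjJ
    refine ⟨⟨fun U hU => hr.1.1 U hU.1, ?_⟩, key⟩
    ext x
    simp only [Set.mem_univ, iff_true]
    obtain ⟨U, hU, hs⟩ := key {x} (hC _ (Set.finite_singleton _) (Set.singleton_nonempty _))
    exact ⟨U, hU, by simpa using hs⟩

theorem hyper_isOpen_sub {X : Type u} [TopologicalSpace X] {𝒜 : Set (Set X)} {U : Set X}
    (hU : IsOpen U) : IsOpen {K : Hyper X 𝒜 | K.1 ⊆ U} :=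
  TopologicalSpace.isOpen_generateFrom_of_mem ⟨U, hU, Or.inl rfl⟩

theorem hyper_isOpen_meet {X : Type u} [TopologicalSpace X] {𝒜 : Set (Set X)} {U : Set X}
    (hU : IsOpen U) : IsOpen {K : Hyper X 𝒜 | (K.1 ∩ U).Nonempty} :=
  TopologicalSpace.isOpen_generateFrom_of_mem ⟨U, hU, Or.inr rfl⟩

/-- If the hyperspace is Rothberger then all members of the ideal are finite. -/
theorem finite_of_rothberger {X : Type u} [TopologicalSpace X] [T2Space X]
    (𝒜 : Set (Set X)) (h𝒜 : IdealOfClosedSets X 𝒜) (hR : RothbergerProp (Hyper X 𝒜)) :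
    ∀ A ∈ 𝒜, A.Finite := by
  intro A hA
  by_contra hinf
  have : Infinite A := Set.infinite_coe_iff.2 hinf
  obtain ⟨W, hWi, hWo, hWd⟩ := exists_seq_infinite_isOpen_pairwise_disjoint A
  have h1 : ∀ n, ∃ O : Set X, IsOpen O ∧ Subtype.val ⁻¹' O = W n := fun n =>
    isOpen_induced_iff.1 (hWo n)
  choose O hO hOW using h1
  have h2 : ∀ n, ∃ d : A, d ∈ W n := fun n => (hWi n).nonempty
  choose d hd using h2
  have hdO : ∀ n, (d n : X) ∈ O n := fun n => by
    have := hd n; rw [← hOW n] at this; exact this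
  have hdn : ∀ m n, (d m : X) ∈ O n → m = n := by
    intro m n h
    by_contra hmn
    have h' : d m ∈ W n := by rw [← hOW n]; exact h
    exact Set.disjoint_left.1 (hWd hmn) (hd m) h'
  have hsing : ∀ x : X, ({x} : Set X) ∈ 𝒜 := fun x =>
    h𝒜.2.1 _ (Set.finite_singleton _) (Set.singleton_nonempty _)
  let P : ℕ → Set (Hyper X 𝒜) := fun n => {K | (K.1 ∩ O (n+1)).Nonempty}
  let Q : ℕ → Set (Hyper X 𝒜) := fun n => {K | K.1 ⊆ {(d (n+1) : X)}ᶜ}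
  have hd0 : ∀ n, (d 0 : X) ∉ O (n+1) := fun n h => by have := hdn _ _ h; omega
  have hcov : ∀ n, ({P n, Q n} : Set (Set (Hyper X 𝒜))) ∈ OX (Hyper X 𝒜) := by
    intro n
    constructor
    · intro U hU
      rcases hU with rfl | rfl
      · refine ⟨hyper_isOpen_meet (hO _), ⟨⟨{(d (n+1) : X)}, hsing _⟩, (d (n+1) : X), rfl, hdO _⟩, ?_⟩
        rw [Set.ne_univ_iff_exists_notMem]
        refine ⟨⟨{(d 0 : X)}, hsing _⟩, ?_⟩
        rintro ⟨x, hx, hx'⟩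
        rw [Set.mem_singleton_iff.1 hx] at hx'
        exact hd0 n hx'
      · refine ⟨hyper_isOpen_sub isOpen_compl_singleton, ⟨⟨{(d 0 : X)}, hsing _⟩, ?_⟩, ?_⟩
        · intro x hx hx'
          rw [Set.mem_singleton_iff.1 hx] at hx'
          apply hd0 n
          rw [Set.mem_singleton_iff.1 hx']
          exact hdO _
        · rw [Set.ne_univ_iff_exists_notMem]
          exact ⟨⟨{(d (n+1) : X)}, hsing _⟩, fun h => h (Set.mem_singleton _) rfl⟩
    · ext K
      simp only [Set.mem_univ, iff_true]
      by_cases h : (d (n+1) : X) ∈ K.1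
      · exact ⟨P n, Or.inl rfl, (d (n+1) : X), h, hdO _⟩
      · exact ⟨Q n, Or.inr rfl, fun x hx hx' => h (by rw [← Set.mem_singleton_iff.1 hx']; exact hx)⟩
  obtain ⟨f, hf, hr⟩ := hR _ hcov
  let S : Set ℕ := {k | k = 0 ∨ ∃ n, k = n+1 ∧ f n = Q n}
  let T : Set X := (fun k => (d k : X)) '' S
  have hTA : closure T ⊆ A := by
    refine closure_minimal ?_ (h𝒜.1 A hA).1
    rintro _ ⟨k, _, rfl⟩
    exact (d k).2
  have hT0 : (d 0 : X) ∈ closure T := subset_closure ⟨0, Or.inl rfl, rfl⟩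
  let K : Hyper X 𝒜 := ⟨closure T, h𝒜.2.2.2 A hA _ hTA isClosed_closure ⟨_, hT0⟩⟩
  have hK : K ∈ ⋃₀ Set.range f := by rw [hr.2]; trivial
  obtain ⟨_, ⟨n, rfl⟩, hKn⟩ := hK
  by_cases hQ : f n = Q n
  · rw [hQ] at hKn
    exact hKn (subset_closure ⟨n+1, Or.inr ⟨n, rfl, hQ⟩, rfl⟩ : (d (n+1) : X) ∈ closure T) rfl
  · have hP : f n = P n := (hf n).resolve_right hQ
    rw [hP] at hKn
    obtain ⟨x, hx, hxO⟩ := hKn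
    obtain ⟨y, hyO, k, hkS, hk⟩ := mem_closure_iff.1 hx _ (hO _) hxO
    rw [← hk] at hyO
    have := hdn _ _ hyO
    subst this
    rcases hkS with h | ⟨m, hm, hm'⟩
    · omega
    · have : n = m := by omega
      subst this
      exact hQ hm'

theorem statement5 {X : Type u} [TopologicalSpace X] [T2Space X]
    (𝒜 : Set (Set X)) (h𝒜 : IdealOfClosedSets X 𝒜) (h𝒜c : ∀ A ∈ 𝒜, IsCompact A)
    (ℬ : Set (Set (Hyper X 𝒜))) (hℬ : IdealOfClosedSets (Hyper X 𝒜) ℬ)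
    (hℬc : ∀ B ∈ ℬ, IsCompact B)
    (hS1a : ∀ K₀ ∈ 𝒜, {K : Hyper X 𝒜 | K.1 ⊆ K₀} ∈ ℬ)
    (hS1b : ∀ Ks ∈ ℬ, (⋃ K ∈ Ks, (K : Hyper X 𝒜).1) ∈ 𝒜)
    (hS2 : ∀ 𝒰 ∈ ACovers X 𝒜,
      ((fun U => {K : Hyper X 𝒜 | K.1 ⊆ U}) '' 𝒰) ∈ ACovers (Hyper X 𝒜) ℬ)
    (hS3 : ∀ 𝒰 ∈ ACovers (Hyper X 𝒜) ℬ,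
      {V : Set X | IsOpen V ∧ V.Nonempty ∧ V ≠ Set.univ ∧
        ∃ U ∈ 𝒰, {K : Hyper X 𝒜 | K.1 ⊆ V} ⊆ U} ∈ ACovers X 𝒜)
    (hS4a : Sfin (ACovers X 𝒜) (groupables (ACovers X 𝒜)) → HurewiczProp X)
    (hS4b : Sfin (ACovers (Hyper X 𝒜) ℬ) (groupables (ACovers (Hyper X 𝒜) ℬ)) →
      HurewiczProp (Hyper X 𝒜))
    (hS5a : MengerProp (Hyper X 𝒜) ↔ Sfin (ACovers (Hyper X 𝒜) ℬ) (ACovers (Hyper X 𝒜) ℬ))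
    (hS5b : Sfin (ACovers (Hyper X 𝒜) ℬ) (ACovers (Hyper X 𝒜) ℬ) ↔
      Sfin (ACovers X 𝒜) (ACovers X 𝒜))
    (hR1 : RothbergerProp (Hyper X 𝒜) ↔ Sone (ACovers (Hyper X 𝒜) ℬ) (ACovers (Hyper X 𝒜) ℬ))
    (hR2 : Sone (ACovers (Hyper X 𝒜) ℬ) (ACovers (Hyper X 𝒜) ℬ) ↔
      Sone (ACovers X 𝒜) (ACovers X 𝒜)) :
    List.TFAE
      [GerlitsNagyProp (Hyper X 𝒜),
       Sone (ACovers (Hyper X 𝒜) ℬ) (groupables (ACovers (Hyper X 𝒜) ℬ)),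
       Sone (ACovers X 𝒜) (groupables (ACovers X 𝒜))] := by
  have hsing : ∀ x : X, ({x} : Set X) ∈ 𝒜 := fun x =>
    h𝒜.2.1 _ (Set.finite_singleton _) (Set.singleton_nonempty _)
  -- the Hurewicz-type selections
  have HX : HurewiczProp (Hyper X 𝒜) → ∀ 𝒰 : ℕ → Set (Set X), (∀ n, 𝒰 n ∈ ACovers X 𝒜) →
      ∃ ℱ : ℕ → Set (Set X), (∀ n, ℱ n ⊆ 𝒰 n ∧ (ℱ n).Finite) ∧
        ∀ A ∈ 𝒜, ∃ m : ℕ, ∀ n ≥ m, ∃ U ∈ ℱ n, A ⊆ U := by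
    intro hH 𝒰 h𝒰
    obtain ⟨ℱ, hℱ, hA⟩ := hH _ (fun n => (hS2 _ (h𝒰 n)).1)
    have h1 : ∀ n, ∃ G : Set (Set X), G ⊆ 𝒰 n ∧ G.Finite ∧
        (fun U => {K : Hyper X 𝒜 | K.1 ⊆ U}) '' G = ℱ n := by
      intro n
      have h0 : ∀ W : ℱ n, ∃ U ∈ 𝒰 n, {K : Hyper X 𝒜 | K.1 ⊆ U} = W.1 := fun W => (hℱ n).1 W.2
      choose u hu hu' using h0
      have := (hℱ n).2.to_subtype
      refine ⟨Set.range u, ?_, Set.finite_range u, ?_⟩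
      · rintro _ ⟨W, rfl⟩
        exact hu W
      · ext W
        constructor
        · rintro ⟨_, ⟨W', rfl⟩, rfl⟩
          simp only [hu' W']
          exact W'.2
        · intro hW
          exact ⟨u ⟨W, hW⟩, ⟨_, rfl⟩, hu' ⟨W, hW⟩⟩
    choose G hG hGf hGe using h1
    refine ⟨G, fun n => ⟨hG n, hGf n⟩, fun A hAA => ?_⟩
    obtain ⟨m, hm⟩ := hA ⟨A, hAA⟩
    refine ⟨m, fun n hn => ?_⟩
    obtain ⟨W, hW, hAW⟩ := hm n hn
    rw [← hGe n] at hW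
    obtain ⟨U, hU, rfl⟩ := hW
    exact ⟨U, hU, hAW⟩
  have HY : HurewiczProp (Hyper X 𝒜) → ∀ 𝒰 : ℕ → Set (Set (Hyper X 𝒜)),
      (∀ n, 𝒰 n ∈ ACovers (Hyper X 𝒜) ℬ) →
      ∃ ℱ : ℕ → Set (Set (Hyper X 𝒜)), (∀ n, ℱ n ⊆ 𝒰 n ∧ (ℱ n).Finite) ∧
        ∀ B ∈ ℬ, ∃ m : ℕ, ∀ n ≥ m, ∃ U ∈ ℱ n, B ⊆ U := by
    intro hH 𝒰 h𝒰
    obtain ⟨ℱ, hℱ, hA⟩ := HX hH _ (fun n => hS3 _ (h𝒰 n))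
    have h1 : ∀ n, ∀ V : Set X, ∃ U, V ∈ ℱ n → U ∈ 𝒰 n ∧ {K : Hyper X 𝒜 | K.1 ⊆ V} ⊆ U := by
      intro n V
      by_cases hV : V ∈ ℱ n
      · obtain ⟨_, _, _, U, hU, hs⟩ := (hℱ n).1 hV
        exact ⟨U, fun _ => ⟨hU, hs⟩⟩
      · exact ⟨∅, fun h => absurd h hV⟩
    choose u hu using h1
    refine ⟨fun n => u n '' ℱ n, fun n => ⟨?_, (hℱ n).2.image _⟩, fun B hB => ?_⟩
    · rintro _ ⟨V, hV, rfl⟩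
      exact (hu n V hV).1
    · obtain ⟨m, hm⟩ := hA _ (hS1b B hB)
      refine ⟨m, fun n hn => ?_⟩
      obtain ⟨V, hV, hs⟩ := hm n hn
      refine ⟨u n V, ⟨V, hV, rfl⟩, fun K hK => (hu n V hV).2 ?_⟩
      exact (Set.subset_biUnion_of_mem (u := fun K : Hyper X 𝒜 => K.1) hK).trans hs
  have hAfin : RothbergerProp (Hyper X 𝒜) → ∀ A ∈ 𝒜, A.Finite := finite_of_rothberger 𝒜 h𝒜
  have hBfin : RothbergerProp (Hyper X 𝒜) → ∀ B ∈ ℬ, B.Finite := by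
    intro hR B hB
    have h1 := hAfin hR _ (hS1b B hB)
    refine Set.Finite.of_finite_image (f := fun K : Hyper X 𝒜 => K.1)
      (h1.finite_subsets.subset ?_) (fun a _ b _ h => Subtype.ext h)
    rintro _ ⟨K, hK, rfl⟩
    exact Set.subset_biUnion_of_mem (u := fun K : Hyper X 𝒜 => K.1) hK
  have h21 : Sone (ACovers (Hyper X 𝒜) ℬ) (groupables (ACovers (Hyper X 𝒜) ℬ)) →
      GerlitsNagyProp (Hyper X 𝒜) := fun h =>
    ⟨hS4b (sfin_of_sone h), hR1.2 (sone_of_gp h)⟩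
  have h12 : GerlitsNagyProp (Hyper X 𝒜) →
      Sone (ACovers (Hyper X 𝒜) ℬ) (groupables (ACovers (Hyper X 𝒜) ℬ)) := fun h =>
    sone_gp hℬ.2.1 (fun B hB => (hℬ.1 B hB).2.1) (hBfin h.2) (hR1.1 h.2) (HY h.1)
  have h13 : GerlitsNagyProp (Hyper X 𝒜) →
      Sone (ACovers X 𝒜) (groupables (ACovers X 𝒜)) := fun h =>
    sone_gp h𝒜.2.1 (fun B hB => (h𝒜.1 B hB).2.1) (hAfin h.2) (hR2.1 (hR1.1 h.2)) (HX h.1)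
  have h31 : Sone (ACovers X 𝒜) (groupables (ACovers X 𝒜)) →
      GerlitsNagyProp (Hyper X 𝒜) := by
    intro h
    refine ⟨?_, hR1.2 (hR2.2 (sone_of_gp h))⟩
    intro 𝒲 h𝒲
    let 𝒱 : ℕ → Set (Set X) := fun n => {V | IsOpen V ∧ V.Nonempty ∧ V ≠ Set.univ ∧
      ∀ i ≤ n, ∃ F : Set (Set (Hyper X 𝒜)), F ⊆ 𝒲 i ∧ F.Finite ∧
        {K : Hyper X 𝒜 | K.1 ⊆ V} ⊆ ⋃₀ F}
    have step : ∀ A ∈ 𝒜, ∀ i, ∃ V : Set X, IsOpen V ∧ V ≠ Set.univ ∧ A ⊆ V ∧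
        ∃ F : Set (Set (Hyper X 𝒜)), F ⊆ 𝒲 i ∧ F.Finite ∧
          {K : Hyper X 𝒜 | K.1 ⊆ V} ⊆ ⋃₀ F := by
      intro A hA i
      by_cases htriv : ∃ F : Set (Set (Hyper X 𝒜)), F ⊆ 𝒲 i ∧ F.Finite ∧ ⋃₀ F = Set.univ
      · obtain ⟨F, hF, hFf, hFu⟩ := htriv
        have := (h𝒜.1 A hA).2.2
        rw [Set.ne_univ_iff_exists_notMem] at this
        obtain ⟨x, hx⟩ := this
        refine ⟨{x}ᶜ, isOpen_compl_singleton, ?_, ?_, F, hF, hFf, ?_⟩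
        · rw [Set.ne_univ_iff_exists_notMem]
          exact ⟨x, fun h => h rfl⟩
        · intro y hy hyx
          rw [Set.mem_singleton_iff.1 hyx] at hy
          exact hx hy
        · rw [hFu]; exact Set.subset_univ _
      · have hcov : {O : Set (Hyper X 𝒜) | O.Nonempty ∧
            ∃ F : Set (Set (Hyper X 𝒜)), F ⊆ 𝒲 i ∧ F.Finite ∧ O = ⋃₀ F} ∈
            ACovers (Hyper X 𝒜) ℬ := by
          have hc : ∀ B ∈ ℬ, ∃ O ∈ {O : Set (Hyper X 𝒜) | O.Nonempty ∧
              ∃ F : Set (Set (Hyper X 𝒜)), F ⊆ 𝒲 i ∧ F.Finite ∧ O = ⋃₀ F}, B ⊆ O := by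
            intro B hB
            obtain ⟨F, hF, hFf, hBF⟩ := (hℬc B hB).elim_finite_subcover_image
              (b := 𝒲 i) (c := fun U => U) (fun U hU => ((h𝒲 i).1 U hU).1)
              (by rw [← Set.sUnion_eq_biUnion, (h𝒲 i).2]; exact Set.subset_univ _)
            rw [← Set.sUnion_eq_biUnion] at hBF
            exact ⟨⋃₀ F, ⟨((hℬ.1 B hB).2.1).mono hBF, F, hF, hFf, rfl⟩, hBF⟩
          refine ⟨⟨?_, ?_⟩, hc⟩
          · rintro O ⟨hOne, F, hF, hFf, rfl⟩
            exact ⟨isOpen_sUnion fun U hU => ((h𝒲 i).1 U (hF hU)).1, hOne,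
              fun hu => htriv ⟨F, hF, hFf, hu⟩⟩
          · ext K
            simp only [Set.mem_univ, iff_true]
            obtain ⟨O, hO, hs⟩ := hc {K}
              (hℬ.2.1 _ (Set.finite_singleton _) (Set.singleton_nonempty _))
            exact ⟨O, hO, by simpa using hs⟩
        obtain ⟨V, ⟨hVo, _, hVu, O, ⟨_, F, hF, hFf, rfl⟩, hVO⟩, hAV⟩ := (hS3 _ hcov).2 A hA
        exact ⟨V, hVo, hVu, hAV, F, hF, hFf, hVO⟩
    have h𝒱 : ∀ n, 𝒱 n ∈ ACovers X 𝒜 := by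
      intro n
      have hc : ∀ A ∈ 𝒜, ∃ V ∈ 𝒱 n, A ⊆ V := by
        intro A hA
        choose V hVo hVu hAV F hF hFf hVF using step A hA
        have hsub : ∀ i ≤ n, (⋂ i ∈ Set.Iic n, V i) ⊆ V i := fun i hi =>
          Set.biInter_subset_of_mem hi
        have hAs : A ⊆ ⋂ i ∈ Set.Iic n, V i := Set.subset_iInter₂ fun i _ => hAV i
        refine ⟨⋂ i ∈ Set.Iic n, V i, ⟨(Set.finite_Iic n).isOpen_biInter fun i _ => hVo i,
          (h𝒜.1 A hA).2.1.mono hAs, ?_, ?_⟩, hAs⟩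
        · intro hu
          apply hVu 0
          have := hsub 0 (Nat.zero_le _)
          rw [hu] at this
          exact Set.univ_subset_iff.1 this
        · intro i hi
          exact ⟨F i, hF i, hFf i, fun K hK => hVF i (Set.Subset.trans hK (hsub i hi))⟩
      refine ⟨⟨fun V hV => ⟨hV.1, hV.2.1, hV.2.2.1⟩, ?_⟩, hc⟩
      ext x
      simp only [Set.mem_univ, iff_true]
      obtain ⟨U, hU, hs⟩ := hc {x} (hsing x)
      exact ⟨U, hU, by simpa using hs⟩
    obtain ⟨f, hf, hr, φ, hφ, hJ⟩ := h 𝒱 h𝒱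
    have hj : ∀ n, ∃ j, n ≤ j ∧ ∀ V ∈ Set.range f, φ V = j → V ∈ 𝒱 n := by
      intro n
      obtain ⟨b, hb⟩ := ((Set.finite_Iio n).image (fun k => φ (f k))).bddAbove
      refine ⟨max n (b+1), le_max_left _ _, ?_⟩
      rintro _ ⟨k, rfl⟩ hk
      have hnk : n ≤ k := by
        by_contra hlt
        have := hb ⟨k, not_le.1 hlt, rfl⟩
        simp only at this
        omega
      obtain ⟨a, b', c, e⟩ := hf k
      exact ⟨a, b', c, fun i hi => e i (hi.trans hnk)⟩
    choose j hjn hjV using hj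
    have hsel : ∀ n, ∀ V : Set X, ∃ F : Set (Set (Hyper X 𝒜)), F ⊆ 𝒲 n ∧ F.Finite ∧
        (V ∈ Set.range f → φ V = j n → {K : Hyper X 𝒜 | K.1 ⊆ V} ⊆ ⋃₀ F) := by
      intro n V
      by_cases hV : V ∈ Set.range f ∧ φ V = j n
      · obtain ⟨F, hF, hFf, hs⟩ := (hjV n V hV.1 hV.2).2.2.2 n le_rfl
        exact ⟨F, hF, hFf, fun _ _ => hs⟩
      · exact ⟨∅, Set.empty_subset _, Set.finite_empty, fun h1 h2 => absurd ⟨h1, h2⟩ hV⟩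
    choose F hF hFf hFs using hsel
    refine ⟨fun n => ⋃ V ∈ {V ∈ Set.range f | φ V = j n}, F n V, fun n =>
      ⟨Set.iUnion₂_subset fun V _ => hF n V, (hφ (j n)).biUnion fun V _ => hFf n V⟩, ?_⟩
    intro K
    have hbad : {i : ℕ | ¬ ∃ V ∈ Set.range f, φ V = i ∧ K.1 ⊆ V}.Finite := by
      by_contra hinf
      obtain ⟨V, ⟨hV, hVJ⟩, hs⟩ := (hJ _ hinf).2 K.1 K.2
      exact hVJ ⟨V, hV, rfl, hs⟩
    obtain ⟨b, hb⟩ := hbad.bddAbove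
    refine ⟨b+1, fun n hn => ?_⟩
    have hgood : ∃ V ∈ Set.range f, φ V = j n ∧ K.1 ⊆ V := by
      by_contra hno
      have := hb hno
      have := hjn n
      omega
    obtain ⟨V, hV, hφV, hKV⟩ := hgood
    obtain ⟨W, hW, hKW⟩ := hFs n V hV hφV hKV
    exact ⟨W, Set.mem_biUnion (show V ∈ {V ∈ Set.range f | φ V = j n} from ⟨hV, hφV⟩) hW, hKW⟩
  tfae_have 1 ↔ 2 := ⟨h12, h21⟩
  tfae_have 1 ↔ 3 := ⟨h13, h31⟩
  tfae_finish
end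

section
/- For any non-compact Hausdorff space X, One has a winning predetermined strategy in the game G_1(𝒦_X, 𝒦_X^gp) if and only if One has a winning strategy in G_1(𝒦_X, 𝒦_X^gp). -/
open Set TopologicalSpace

universe u

theorem mkK {X : Type u} [TopologicalSpace X] {𝒰 : Set (Set X)}
    (h1 : ∀ U ∈ 𝒰, IsOpen U ∧ U.Nonempty ∧ U ≠ Set.univ)
    (h2 : ∀ K : Set X, IsCompact K → K.Nonempty → ∃ U ∈ 𝒰, K ⊆ U) : 𝒰 ∈ KCovers X := by
  refine ⟨⟨h1, ?_⟩, h2⟩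
  ext x
  simp only [Set.mem_sUnion, Set.mem_univ, iff_true]
  obtain ⟨U, hU, hx⟩ := h2 {x} isCompact_singleton (Set.singleton_nonempty x)
  exact ⟨U, hU, hx rfl⟩

theorem kc_diff {X : Type u} [TopologicalSpace X] [Nonempty X] {𝒰 : Set (Set X)}
    (h : 𝒰 ∈ KCovers X) (s : List (Set X)) : {U ∈ 𝒰 | U ∉ s} ∈ KCovers X := by
  classical
  have hx : ∀ U : Set X, ∃ x, U ≠ Set.univ → x ∉ U := by
    intro U
    by_cases hU : U = Set.univ
    · exact ⟨Classical.arbitrary X, fun h => absurd hU h⟩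
    · obtain ⟨x, hx⟩ := (Set.ne_univ_iff_exists_notMem U).1 hU
      exact ⟨x, fun _ => hx⟩
  choose p hp using hx
  refine mkK (fun U hU => h.1.1 U hU.1) ?_
  intro K hK hne
  have hfin : (p '' {U | U ∈ s}).Finite := (List.finite_toSet s).image p
  obtain ⟨U, hU, hKU⟩ := h.2 (K ∪ p '' {U | U ∈ s}) (hK.union hfin.isCompact)
    (hne.mono Set.subset_union_left)
  refine ⟨U, ⟨hU, fun hs => ?_⟩, Set.subset_union_left.trans hKU⟩
  exact hp U (h.1.1 U hU).2.2 (hKU (Or.inr ⟨U, hs, rfl⟩))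

/-- Hurewicz-type property from the selection principle. -/
theorem hurK {X : Type u} [TopologicalSpace X]
    (hS : Sone (KCovers X) (groupables (KCovers X)))
    (E : ℕ → ℕ → Set X) (hE : ∀ m, Set.range (E m) ∈ KCovers X) :
    ∃ g : ℕ → ℕ, ∀ K : Set X, IsCompact K → K.Nonempty →
      ∃ N, ∀ m ≥ N, ∃ i ≤ g m, K ⊆ E m i := by
  classical
  obtain ⟨D, hD, hDK, φ, hφ, hJ⟩ := hS
    (fun m => {D | (IsOpen D ∧ D.Nonempty ∧ D ≠ Set.univ) ∧ ∀ j ≤ m, ∃ i, D ⊆ E j i}) (by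
    intro m
    refine mkK (fun U hU => hU.1) ?_
    intro K hK hne
    have : ∀ j, ∃ i, K ⊆ E j i := by
      intro j
      obtain ⟨_, ⟨i, rfl⟩, h⟩ := (hE j).2 K hK hne
      exact ⟨i, h⟩
    choose i hi using this
    refine ⟨⋂ j ∈ Finset.range (m+1), E j (i j), ⟨⟨?_, ?_, ?_⟩, ?_⟩, ?_⟩
    · exact isOpen_biInter_finset fun j _ => ((hE j).1.1 _ ⟨i j, rfl⟩).1
    · exact hne.mono (Set.subset_iInter₂ fun j _ => hi j)
    · intro hu
      apply ((hE 0).1.1 _ ⟨i 0, rfl⟩).2.2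
      apply Set.eq_univ_of_univ_subset
      rw [← hu]
      exact Set.biInter_subset_of_mem (by simp)
    · intro j hj
      exact ⟨i j, Set.biInter_subset_of_mem (by simp; omega)⟩
    · exact Set.subset_iInter₂ fun j _ => hi j)
  have key : ∀ m, ∃ b, ∃ k ≥ m, ∀ U ∈ Set.range D, φ U = k → ∃ i ≤ b, U ⊆ E m i := by
    intro m
    obtain ⟨k, hk⟩ : ∃ k, k = m + ∑ j ∈ Finset.range m, (φ (D j) + 1) := ⟨_, rfl⟩
    have hk1 : ∀ j < m, φ (D j) < k := by
      intro j hj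
      have := Finset.single_le_sum (f := fun j => φ (D j) + 1) (fun _ _ => Nat.zero_le _)
        (Finset.mem_range.2 hj)
      omega
    have h1 : ∀ U, ∃ i, (U ∈ Set.range D ∧ φ U = k) → U ⊆ E m i := by
      intro U
      by_cases hU : U ∈ Set.range D ∧ φ U = k
      · obtain ⟨⟨j, rfl⟩, hj⟩ := hU
        have : m ≤ j := by
          by_contra hc
          have := hk1 j (by omega)
          omega
        obtain ⟨i, hi⟩ := (hD j).2 m this
        exact ⟨i, fun _ => hi⟩
      · exact ⟨0, fun h => absurd h hU⟩
    choose i hi using h1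
    obtain ⟨b, hb⟩ := ((hφ k).image i).bddAbove
    refine ⟨b, k, by omega, fun U hU hUk => ⟨i U, hb ⟨U, ⟨hU, hUk⟩, rfl⟩, hi U ⟨hU, hUk⟩⟩⟩
  choose g k hk hg using key
  refine ⟨g, fun K hK hne => ?_⟩
  have hfin : {n | ¬ ∃ U ∈ Set.range D, φ U = n ∧ K ⊆ U}.Finite := by
    by_contra hinf
    obtain ⟨U, ⟨hU, hU2⟩, hKU⟩ := (hJ _ hinf).2 K hK hne
    exact hU2 ⟨U, hU, rfl, hKU⟩
  obtain ⟨N, hN⟩ := hfin.bddAbove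
  refine ⟨N + 1, fun m hm => ?_⟩
  have : ∃ U ∈ Set.range D, φ U = k m ∧ K ⊆ U := by
    by_contra hc
    have h1 := hN hc
    have := hk m
    omega
  obtain ⟨U, hU, hUk, hKU⟩ := this
  obtain ⟨i, hi, h⟩ := hg m U hU hUk
  exact ⟨i, hi, hKU.trans h⟩

/-- Positions of the game, coded by (reversed) lists of indices. -/
def posK {X : Type u} (c : List (Set X) → ℕ → Set X) : List ℕ → List (Set X)
  | [] => []
  | i :: t => posK c t ++ [c (posK c t) i]

/-- The finitely branching tree bounded by `g`. -/
def treeK (g : List ℕ → ℕ) : ℕ → Finset (List ℕ)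
  | 0 => {[]}
  | n + 1 => (treeK g n).biUnion fun t => (Finset.range (g t + 1)).image fun i => i :: t

theorem treeK_length (g : List ℕ → ℕ) (n : ℕ) : ∀ t ∈ treeK g n, t.length = n := by
  induction n with
  | zero => simp [treeK]
  | succ n ih =>
    intro t ht
    simp only [treeK, Finset.mem_biUnion, Finset.mem_image] at ht
    obtain ⟨s, hs, i, _, rfl⟩ := ht
    simp [ih s hs]

/-- The branch determined by `H`. -/
def branchK (H : List ℕ → ℕ) : ℕ → List ℕ
  | 0 => []
  | n + 1 => H (branchK H n) :: branchK H n

theorem branchK_mem (g H : List ℕ → ℕ) (h : ∀ t, H t ≤ g t) (n : ℕ) :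
    branchK H n ∈ treeK g n := by
  induction n with
  | zero => simp [treeK, branchK]
  | succ n ih =>
    simp only [treeK, branchK, Finset.mem_biUnion, Finset.mem_image]
    exact ⟨_, ih, _, by simp [h], rfl⟩

theorem branchK_length (H : List ℕ → ℕ) (n : ℕ) : (branchK H n).length = n :=
  treeK_length H n _ (branchK_mem H H (fun _ => le_rfl) n)

theorem posK_branchK {X : Type u} (c : List (Set X) → ℕ → Set X) (H : List ℕ → ℕ) (n : ℕ) :
    posK c (branchK H n) =
      List.ofFn fun i : Fin n => c (posK c (branchK H i)) (H (branchK H i)) := by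
  induction n with
  | zero => simp [posK, branchK]
  | succ n ih =>
    rw [List.ofFn_succ_last]
    simp only [branchK, posK, Fin.val_castSucc, Fin.val_last]
    rw [← ih]

theorem gameK {X : Type u} [TopologicalSpace X] [Nonempty X]
    (hS : Sone (KCovers X) (groupables (KCovers X)))
    (σ : List (Set X) → Set (Set X)) (hσ : ∀ s, σ s ∈ KCovers X) :
    ∃ f : ℕ → Set X, (∀ n, f n ∈ σ (List.ofFn fun i : Fin n => f i)) ∧
      Set.range f ∈ groupables (KCovers X) := by
  classical
  have hc : ∀ s, ∃ e : ℕ → Set X, (∀ n, e n ∈ σ s ∧ e n ∉ s) ∧ Set.range e ∈ KCovers X := by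
    intro s
    obtain ⟨e, he, hK, _⟩ := hS (fun _ => _) (fun _ => kc_diff (hσ s) s)
    exact ⟨e, he, hK⟩
  choose c hcm hcK using hc
  obtain ⟨E, hE⟩ : ∃ E : List ℕ → ℕ → Set X, E = fun t n => c (posK c t) n := ⟨_, rfl⟩
  have hEo : ∀ t i, IsOpen (E t i) ∧ (E t i).Nonempty ∧ E t i ≠ Set.univ := by
    intro t i
    rw [hE]
    exact (hσ _).1.1 _ (hcm _ i).1
  obtain ⟨g, hg⟩ : ∃ g : List ℕ → ℕ, ∀ K : Set X, IsCompact K → K.Nonempty →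
      ∃ N, ∀ t : List ℕ, N ≤ t.length → ∃ i ≤ g t, K ⊆ E t i := by
    let e : List ℕ ≃ ℕ := Denumerable.eqv (List ℕ)
    obtain ⟨g, hg⟩ := hurK hS (fun m => E (e.symm m)) (by
      intro m
      rw [hE]
      exact hcK _)
    refine ⟨fun t => g (e t), fun K hK hne => ?_⟩
    obtain ⟨N, hN⟩ := hg K hK hne
    refine ⟨(∑ m ∈ Finset.range N, ((e.symm m).length + 1)), fun t ht => ?_⟩
    have : N ≤ e t := by
      by_contra hlt
      have := Finset.single_le_sum (f := fun m => (e.symm m).length + 1)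
        (fun _ _ => Nat.zero_le _) (Finset.mem_range.2 (not_le.1 hlt))
      simp only [Equiv.symm_apply_apply] at this
      omega
    simpa using hN (e t) this
  obtain ⟨W, hW, hWK, φ, hφ, hJ⟩ := hS
    (fun m => {W | (IsOpen W ∧ W.Nonempty ∧ W ≠ Set.univ) ∧ ∃ S : Finset ℕ, S.card = m + 1 ∧
      ∃ h : List ℕ → ℕ, (∀ t, h t ≤ g t) ∧ ∀ n ∈ S, ∀ t ∈ treeK g n, W ⊆ E t (h t)}) (by
    intro m
    refine mkK (fun U hU => hU.1) ?_
    intro K hK hne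
    obtain ⟨N, hN⟩ := hg K hK hne
    have : ∀ t : List ℕ, ∃ i ≤ g t, N ≤ t.length → K ⊆ E t i := by
      intro t
      by_cases ht : N ≤ t.length
      · obtain ⟨i, hi, h⟩ := hN t ht
        exact ⟨i, hi, fun _ => h⟩
      · exact ⟨0, Nat.zero_le _, fun h => absurd h ht⟩
    choose h hhg hh using this
    obtain ⟨B, hB⟩ : ∃ B, B = (Finset.Ico N (N + (m + 1))).biUnion (treeK g) := ⟨_, rfl⟩
    have hKB : K ⊆ ⋂ t ∈ B, E t (h t) := by
      refine Set.subset_iInter₂ fun t ht => hh t ?_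
      rw [hB, Finset.mem_biUnion] at ht
      obtain ⟨n, hn, ht⟩ := ht
      rw [treeK_length g n t ht]
      exact (Finset.mem_Ico.1 hn).1
    have hsub : ∀ n ∈ Finset.Ico N (N + (m + 1)), ∀ t ∈ treeK g n,
        (⋂ t ∈ B, E t (h t)) ⊆ E t (h t) := by
      intro n hn t ht
      apply Set.biInter_subset_of_mem
      rw [hB]
      exact Finset.mem_coe.2 (Finset.mem_biUnion.2 ⟨n, hn, ht⟩)
    refine ⟨⋂ t ∈ B, E t (h t), ⟨⟨?_, hne.mono hKB, ?_⟩, Finset.Ico N (N + (m + 1)),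
      by simp, h, hhg, hsub⟩, hKB⟩
    · exact isOpen_biInter_finset fun t _ => (hEo _ _).1
    · intro hu
      have := hsub N (by simp) _ (branchK_mem g h hhg N)
      rw [hu] at this
      exact (hEo _ _).2.2 (Set.eq_univ_of_univ_subset this))
  choose hWo S hScard h hhg hWS using hW
  obtain ⟨n, hninj, hnS⟩ := (Finset.all_card_le_biUnion_card_iff_exists_injective S).1 (by
    intro s
    rcases s.eq_empty_or_nonempty with rfl | hs
    · simp
    · have h1 : s ⊆ Finset.range (s.max' hs + 1) := by
        intro x hx
        have := s.le_max' x hx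
        simp
        omega
      have h2 := Finset.card_le_card h1
      have h3 := Finset.card_le_card (Finset.subset_biUnion_of_mem S (s.max'_mem hs))
      rw [hScard] at h3
      simp at h2
      omega)
  have hH : ∀ t : List ℕ, ∃ i ≤ g t, ∀ m, n m = t.length → i = h m t := by
    intro t
    by_cases ht : ∃ m, n m = t.length
    · obtain ⟨m, hm⟩ := ht
      refine ⟨h m t, hhg m t, fun m' hm' => ?_⟩
      rw [hninj (hm'.trans hm.symm)]
    · exact ⟨0, Nat.zero_le _, fun m hm => absurd ⟨m, hm⟩ ht⟩
  choose H hHg hHh using hH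
  obtain ⟨f, hf⟩ : ∃ f : ℕ → Set X,
    f = fun j => c (posK c (branchK H j)) (H (branchK H j)) := ⟨_, rfl⟩
  have hpos : ∀ j, posK c (branchK H j) = List.ofFn fun i : Fin j => f i := by
    intro j
    rw [posK_branchK, hf]
  have hfc : ∀ j, f j = c (List.ofFn fun i : Fin j => f i) (H (branchK H j)) := by
    intro j
    rw [← hpos j, hf]
  have hfE : ∀ j, f j = E (branchK H j) (H (branchK H j)) := by
    intro j
    rw [hE, hf]
  have hfmem : ∀ j, f j ∈ σ (List.ofFn fun i : Fin j => f i) := by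
    intro j
    have := (hcm (List.ofFn fun i : Fin j => f i) (H (branchK H j))).1
    rwa [← hfc] at this
  have hfne : ∀ i j, i < j → f i ≠ f j := by
    intro i j hij heq
    have := (hcm (List.ofFn fun i : Fin j => f i) (H (branchK H j))).2
    rw [← hfc] at this
    apply this
    rw [List.mem_ofFn]
    exact ⟨⟨i, hij⟩, heq⟩
  have hfinj : Function.Injective f := by
    intro i j hij
    rcases lt_trichotomy i j with h1 | h1 | h1
    · exact absurd hij (hfne i j h1)
    · exact h1
    · exact absurd hij.symm (hfne j i h1)
  have hWf : ∀ m, W m ⊆ f (n m) := by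
    intro m
    rw [hfE, hHh (branchK H (n m)) m (branchK_length H (n m)).symm]
    exact hWS m (n m) (hnS m) _ (branchK_mem g H hHg _)
  have hψ : ∀ j, ∃ k, (∀ m, n m = j → (∀ m' < m, W m' ≠ W m) → k = φ (W m)) ∧
      (k = j ∨ ∃ m, n m = j ∧ (∀ m' < m, W m' ≠ W m) ∧ k = φ (W m)) := by
    intro j
    by_cases hj : ∃ m, n m = j ∧ ∀ m' < m, W m' ≠ W m
    · obtain ⟨m, hm, hm2⟩ := hj
      refine ⟨φ (W m), fun m' hm' _ => ?_, Or.inr ⟨m, hm, hm2, rfl⟩⟩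
      rw [hninj (hm'.trans hm.symm)]
    · exact ⟨j, fun m hm hm2 => absurd ⟨m, hm, hm2⟩ hj, Or.inl rfl⟩
  choose ψ hψ1 hψ2 using hψ
  have hGJ : ∀ J : Set ℕ, J.Infinite →
      {x ∈ Set.range f | ψ (Function.invFun f x) ∈ J} ∈ KCovers X := by
    intro J hJi
    refine mkK ?_ ?_
    · rintro _ ⟨⟨j, rfl⟩, _⟩
      rw [hfE]
      exact hEo _ _
    · intro K hK hne
      obtain ⟨V, ⟨hV, hVJ⟩, hKV⟩ := (hJ J hJi).2 K hK hne
      have hex : ∃ m, W m = V := hV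
      have hm := Nat.find_spec hex
      have hmin : ∀ m' < Nat.find hex, W m' ≠ W (Nat.find hex) := by
        intro m' hm' heq
        exact Nat.find_min hex hm' (heq.trans hm)
      refine ⟨f (n (Nat.find hex)), ⟨⟨_, rfl⟩, ?_⟩, ?_⟩
      · rw [Function.leftInverse_invFun hfinj, hψ1 _ _ rfl hmin, hm]
        exact hVJ
      · refine hKV.trans ?_
        have := hWf (Nat.find hex)
        rwa [hm] at this
  refine ⟨f, hfmem, ?_, fun x => ψ (Function.invFun f x), ?_, hGJ⟩
  · have := hGJ Set.univ Set.infinite_univ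
    simp only [Set.mem_univ, and_true, Set.setOf_mem_eq] at this
    exact this
  · intro k
    have hA : {m | (∀ m' < m, W m' ≠ W m) ∧ φ (W m) = k}.Finite := by
      refine Set.Finite.of_finite_image (f := W) ((hφ k).subset ?_) ?_
      · rintro _ ⟨m, hm, rfl⟩
        exact ⟨⟨m, rfl⟩, hm.2⟩
      · intro a ha b hb hab
        rcases lt_trichotomy a b with h1 | h1 | h1
        · exact absurd hab (hb.1 a h1)
        · exact h1
        · exact absurd hab.symm (ha.1 b h1)
    refine (((hA.image n).union (Set.finite_singleton k)).image f).subset ?_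
    rintro _ ⟨⟨j, rfl⟩, hj⟩
    change ψ (Function.invFun f (f j)) = k at hj
    rw [Function.leftInverse_invFun hfinj] at hj
    refine ⟨j, ?_, rfl⟩
    rcases hψ2 j with h1 | ⟨m, hm, hm2, hm3⟩
    · right
      exact h1.symm.trans hj
    · left
      exact ⟨m, ⟨hm2, hm3.symm.trans hj⟩, hm⟩

theorem statement9 {X : Type u} [TopologicalSpace X] [T2Space X] (hX : ¬ CompactSpace X) :
    OneWinsPreGone (KCovers X) (groupables (KCovers X)) ↔
      OneWinsGone (KCovers X) (groupables (KCovers X)) := by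
  constructor
  · rintro ⟨σ, hσ, hw⟩
    exact ⟨fun s => σ s.length, fun s => hσ _, fun f hf => hw f fun n => by simpa using hf n⟩
  · rintro ⟨σ, hσ, hw⟩
    by_contra hno
    have hne : Nonempty X := by
      by_contra he
      rw [not_nonempty_iff] at he
      exact hX inferInstance
    have hS : Sone (KCovers X) (groupables (KCovers X)) := by
      intro 𝒰 h𝒰
      by_contra hc
      exact hno ⟨𝒰, h𝒰, fun f hf hr => hc ⟨f, hf, hr⟩⟩
    obtain ⟨f, hf, hr⟩ := gameK hS σ hσ
    exact hw f hf hr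
end

section
/- Let X be an infinite Hausdorff space. The following are equivalent: (i) 𝒫_fin(X) is Gerlits-Nagy; (ii) 𝒫_fin(X) satisfies S_1(Ω_{𝒫_fin(X)}, Ω_{𝒫_fin(X)}^gp); (iii) X satisfies S_1(Ω_X, Ω_X^gp); (iv) every finite power Xⁿ (n ≥ 1, with the product topology) is Gerlits-Nagy; (v) One does not have a winning strategy in the game G_1(Ω_X, Ω_X^gp). -/
open Set TopologicalSpace

universe u

/-! ### Indexed versions of the covering properties -/

/-- Indexed form of the Hurewicz property for countable covers. -/
def HurI (Y : Type u) [TopologicalSpace Y] : Prop :=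
  ∀ V : ℕ → ℕ → Set Y, (∀ n k, IsOpen (V n k)) → (∀ n y, ∃ k, y ∈ V n k) →
    ∃ h : ℕ → ℕ, ∀ y, ∃ m, ∀ n ≥ m, ∃ k < h n, y ∈ V n k

/-- Indexed form of the Rothberger property. -/
def RothI (Y : Type u) [TopologicalSpace Y] : Prop :=
  ∀ (β : Type u) (A : ℕ → Set β) (V : ℕ → β → Set Y), (∀ n, ∀ b ∈ A n, IsOpen (V n b)) →
    (∀ n y, ∃ b ∈ A n, y ∈ V n b) →
    ∃ b : ℕ → β, (∀ n, b n ∈ A n) ∧ ∀ y, ∃ n, y ∈ V n (b n)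

theorem rothI_of_prop {Y : Type u} [TopologicalSpace Y] [Nonempty Y] (h : RothbergerProp Y) :
    RothI Y := by
  intro β A V hV hc
  have hne : ∀ n, ∃ b, b ∈ A n := fun n => by
    obtain ⟨b, hb, -⟩ := hc n (Classical.arbitrary Y)
    exact ⟨b, hb⟩
  by_cases hu : ∃ n, ∃ b ∈ A n, V n b = univ
  · obtain ⟨n, b, hb, hbu⟩ := hu
    choose c hc' using hne
    refine ⟨fun m => if m = n then b else c m, ?_, ?_⟩
    · intro m
      by_cases hm : m = n
      · subst hm; simpa using hb
      · simpa [hm] using hc' m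
    · intro y
      exact ⟨n, by simp [hbu]⟩
  · push Not at hu
    obtain ⟨f, hf, hr⟩ := h (fun n => {S | S.Nonempty ∧ ∃ b ∈ A n, S = V n b}) (by
      intro n
      refine ⟨?_, ?_⟩
      · rintro S ⟨hS, b, hb, rfl⟩
        exact ⟨hV n b hb, hS, hu n b hb⟩
      · refine eq_univ_of_forall fun y => ?_
        obtain ⟨b, hb, hy⟩ := hc n y
        exact ⟨V n b, ⟨⟨y, hy⟩, b, hb, rfl⟩, hy⟩)
    choose hfn b hb hfb using hf
    refine ⟨b, hb, fun y => ?_⟩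
    have : y ∈ ⋃₀ Set.range f := by rw [hr.2]; trivial
    obtain ⟨_, ⟨n, rfl⟩, hy⟩ := this
    exact ⟨n, by rw [← hfb]; exact hy⟩

theorem hurI_of_prop {Y : Type u} [TopologicalSpace Y] (h : HurewiczProp Y) :
    HurI Y := by
  classical
  intro V hV hc
  by_cases hu : ∀ n, ∃ k, V n k = univ
  · choose k hk using hu
    refine ⟨fun n => k n + 1, fun y => ⟨0, fun n _ => ⟨k n, by simp, by simp [hk]⟩⟩⟩
  · push Not at hu
    obtain ⟨n0, hn0⟩ := hu
    let g : ℕ → ℕ := fun n => if ∃ k, V n k = univ then n0 else n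
    have hg : ∀ n k, V (g n) k ≠ univ := by
      intro n k
      by_cases hn : ∃ k, V n k = univ
      · simp only [g, hn, if_true]; exact hn0 k
      · simp only [g, hn, if_false]; push Not at hn; exact hn k
    obtain ⟨ℱ, hℱ, hy⟩ := h (fun n => {S | S.Nonempty ∧ ∃ k, S = V (g n) k}) (by
      intro n
      refine ⟨?_, ?_⟩
      · rintro S ⟨hS, k, rfl⟩
        exact ⟨hV _ k, hS, hg n k⟩
      · refine eq_univ_of_forall fun y => ?_
        obtain ⟨k, hy⟩ := hc (g n) y
        exact ⟨V (g n) k, ⟨⟨y, hy⟩, k, rfl⟩, hy⟩)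
    have key : ∀ n, ∃ N, ∀ S ∈ ℱ n, ∃ k < N, S = V (g n) k := by
      intro n
      have h1 : ∀ S : ℱ n, ∃ k, (S : Set Y) = V (g n) k := fun S => ((hℱ n).1 S.2).2
      choose k hk using h1
      have := (hℱ n).2.fintype
      refine ⟨Finset.univ.sup k + 1, fun S hS => ⟨k ⟨S, hS⟩, ?_, hk ⟨S, hS⟩⟩⟩
      exact Nat.lt_succ_of_le (Finset.le_sup (Finset.mem_univ _))
    choose N hN using key
    have h2 : ∀ n, ∃ M, (∃ k < M, V n k = univ) ∨ ((¬ ∃ k, V n k = univ) ∧ M = N n) := by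
      intro n
      by_cases hn : ∃ k, V n k = univ
      · obtain ⟨k, hk⟩ := hn
        exact ⟨k + 1, Or.inl ⟨k, by simp, hk⟩⟩
      · exact ⟨N n, Or.inr ⟨hn, rfl⟩⟩
    choose M hM using h2
    refine ⟨M, fun y => ?_⟩
    obtain ⟨m, hm⟩ := hy y
    refine ⟨m, fun n hn => ?_⟩
    rcases hM n with ⟨k, hk, hk'⟩ | ⟨hn', hMN⟩
    · exact ⟨k, hk, by simp [hk']⟩
    · obtain ⟨S, hS, hyS⟩ := hm n hn
      obtain ⟨k, hk, rfl⟩ := hN n S hS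
      refine ⟨k, by rw [hMN]; exact hk, ?_⟩
      simpa [g, hn'] using hyS

/-- Rothberger, with every point covered infinitely often. -/
theorem rothI_inf {Y : Type u} [TopologicalSpace Y] (h : RothI Y)
    (β : Type u) (A : ℕ → Set β) (V : ℕ → β → Set Y) (hV : ∀ n, ∀ b ∈ A n, IsOpen (V n b))
    (hc : ∀ n y, ∃ b ∈ A n, y ∈ V n b) :
    ∃ b : ℕ → β, (∀ n, b n ∈ A n) ∧ ∀ y, {n | y ∈ V n (b n)}.Infinite := by
  have h1 : ∀ a : ℕ, ∃ b : ℕ → β, (∀ n, b n ∈ A (Nat.pair a n)) ∧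
      ∀ y, ∃ n, y ∈ V (Nat.pair a n) (b n) := fun a =>
    h β (fun n => A (Nat.pair a n)) (fun n => V (Nat.pair a n)) (fun n b hb => hV _ b hb)
      (fun n y => hc _ y)
  choose b hb hy using h1
  refine ⟨fun n => b n.unpair.1 n.unpair.2, fun n => ?_, fun y => ?_⟩
  · have := hb n.unpair.1 n.unpair.2
    rwa [Nat.pair_unpair] at this
  · choose c hc using fun a => hy a y
    refine Set.infinite_of_injective_forall_mem (f := fun a => Nat.pair a (c a)) ?_ ?_
    · intro a a' haa
      exact (Nat.pair_eq_pair.1 haa).1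
    · intro a
      simpa using hc a

/-- Pawlikowski-style selection from families that cover each point infinitely often. -/
theorem rothI_select {Y : Type u} [TopologicalSpace Y] (h : RothI Y)
    (β : Type u) (A : ℕ → Set β) (V : ℕ → β → Set Y) (hV : ∀ n, ∀ b ∈ A n, IsOpen (V n b))
    (hA : ∀ n, (A n).Nonempty)
    (hc : ∀ y, {n | ∃ b ∈ A n, y ∈ V n b}.Infinite) :
    ∃ b : ℕ → β, (∀ n, b n ∈ A n) ∧ ∀ y, {n | y ∈ V n (b n)}.Infinite := by
  classical
  obtain ⟨W, hW, hWy⟩ := rothI_inf h (Set Y)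
    (fun j => {W | IsOpen W ∧ ∃ I : Finset ℕ, I.card = j + 1 ∧ ∀ i ∈ I, ∃ b ∈ A i, W ⊆ V i b})
    (fun _ W => W) (fun n W hW => hW.1) (by
      intro j y
      obtain ⟨I, hI, hcard⟩ := (hc y).exists_subset_card_eq (j + 1)
      have h1 : ∀ i : I, ∃ b ∈ A i, y ∈ V i b := fun i => hI i.2
      choose b hb hyb using h1
      refine ⟨⋂ i : I, V i (b i), ⟨isOpen_iInter_of_finite fun i => hV _ _ (hb i), I, hcard, ?_⟩,
        mem_iInter.2 hyb⟩
      intro i hi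
      exact ⟨b ⟨i, hi⟩, hb ⟨i, hi⟩, iInter_subset (fun i : I => V i (b i)) ⟨i, hi⟩⟩)
  have hI : ∀ j, ∃ I : Finset ℕ, I.card = j + 1 ∧ ∀ i ∈ I, ∃ b ∈ A i, W j ⊆ V i b :=
    fun j => (hW j).2
  choose I hIc hIb using hI
  obtain ⟨g, hginj, hg⟩ := (Finset.all_card_le_biUnion_card_iff_exists_injective I).1 (by
    intro s
    rcases s.eq_empty_or_nonempty with rfl | hs
    · simp
    · have hm := s.max'_mem hs
      calc s.card ≤ (Finset.range (s.max' hs + 1)).card := by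
            apply Finset.card_le_card
            intro x hx
            simpa [Nat.lt_succ_iff] using s.le_max' x hx
        _ = (I (s.max' hs)).card := by rw [hIc]; simp
        _ ≤ _ := Finset.card_le_card (Finset.subset_biUnion_of_mem I hm))
  have hsel : ∀ n, ∃ b ∈ A n, ∀ j, g j = n → W j ⊆ V n b := by
    intro n
    by_cases hn : ∃ j, g j = n
    · obtain ⟨j, rfl⟩ := hn
      obtain ⟨b, hb, hWb⟩ := hIb j (g j) (hg j)
      refine ⟨b, hb, fun j' hj' => ?_⟩
      rw [hginj hj']; exact hWb
    · obtain ⟨b, hb⟩ := hA n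
      exact ⟨b, hb, fun j hj => (hn ⟨j, hj⟩).elim⟩
  choose b hb hbW using hsel
  refine ⟨b, hb, fun y => ?_⟩
  refine ((hWy y).image hginj.injOn).mono ?_
  rintro _ ⟨j, hj, rfl⟩
  exact hbW (g j) j rfl hj

/-- The position reached after following indices `l` (most recent first). -/
def pos {α : Type u} (e : List α → ℕ → α) : List ℕ → List α
  | [] => []
  | k :: l => pos e l ++ [e (pos e l) k]

/-- Finite levels of the bounded tree. -/
def lev (h : List ℕ → ℕ) : ℕ → Set (List ℕ)
  | 0 => {[]}
  | n + 1 => ⋃ l ∈ lev h n, (fun k => k :: l) '' {k | k < h l}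

theorem lev_finite (h : List ℕ → ℕ) (n : ℕ) : (lev h n).Finite := by
  induction n with
  | zero => simp [lev]
  | succ n ih => exact ih.biUnion fun l _ => (Set.finite_lt_nat _).image _

theorem lev_length (h : List ℕ → ℕ) (n : ℕ) : ∀ l ∈ lev h n, l.length = n := by
  induction n with
  | zero => simp [lev]
  | succ n ih =>
    intro l hl
    simp only [lev, mem_iUnion] at hl
    obtain ⟨m, hm, k, -, rfl⟩ := hl
    simp [ih m hm]

/-- Branch through the tree. -/
def branch (b : ℕ → List ℕ → ℕ) : ℕ → List ℕ
  | 0 => []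
  | n + 1 => b n (branch b n) :: branch b n

/-- The core game theorem. -/
theorem core_game {Y : Type u} [TopologicalSpace Y] (hR : RothI Y) (hH : HurI Y)
    {α : Type u} (τ : List α → Set α) (P : α → Set Y)
    (hP : ∀ s, ∀ u ∈ τ s, IsOpen (P u)) (hc : ∀ s y, ∃ u ∈ τ s, y ∈ P u) :
    ∃ f : ℕ → α, (∀ n, f n ∈ τ (List.ofFn fun i : Fin n => f i)) ∧
      ∀ y, {n | y ∈ P (f n)}.Infinite := by
  classical
  have h1 : ∀ s, ∃ e : ℕ → α, (∀ k, e k ∈ τ s) ∧ ∀ y, ∃ k, y ∈ P (e k) := fun s =>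
    hR α (fun _ => τ s) (fun _ => P) (fun _ => hP s) (fun _ => hc s)
  choose e he hey using h1
  obtain ⟨h0, hh0⟩ := hH (fun n k => P (e (pos e (Denumerable.ofNat (List ℕ) n)) k))
    (fun n k => hP _ _ (he _ k)) (fun n y => hey _ y)
  let h : List ℕ → ℕ := fun l => h0 (Encodable.encode l) + 1
  have hfin : ∀ y, {l | ¬ ∃ k < h l, y ∈ P (e (pos e l) k)}.Finite := by
    intro y
    obtain ⟨m, hm⟩ := hh0 y
    refine Set.Finite.of_finite_image (f := Encodable.encode)
      ((Set.finite_lt_nat m).subset ?_) (Encodable.encode_injective.injOn)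
    rintro _ ⟨l, hl, rfl⟩
    by_contra hlt
    apply hl
    obtain ⟨k, hk, hy⟩ := hm (Encodable.encode l) (not_lt.1 hlt)
    rw [Denumerable.ofNat_encode] at hy
    exact ⟨k, Nat.lt_succ_of_lt hk, hy⟩
  obtain ⟨b, hb, hby⟩ := rothI_select hR (ULift.{u} (List ℕ → ℕ))
    (fun n => {k | ∀ l ∈ lev h n, k.down l < h l})
    (fun n k => ⋂ l ∈ lev h n, P (e (pos e l) (k.down l)))
    (fun n k _ => (lev_finite h n).isOpen_biInter fun l _ => hP _ _ (he _ _))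
    (fun n => ⟨⟨fun _ => 0⟩, fun l _ => Nat.succ_pos _⟩) (by
      intro y
      obtain ⟨N, hN⟩ := ((hfin y).image List.length).bddAbove
      refine (Set.infinite_of_injective_forall_mem (f := fun n => n + (N + 1))
        (add_left_injective _) ?_)
      intro n
      have h2 : ∀ l, ∃ k, l ∈ lev h (n + (N + 1)) → k < h l ∧ y ∈ P (e (pos e l) k) := by
        intro l
        by_cases hl : l ∈ lev h (n + (N + 1))
        · have : ∃ k < h l, y ∈ P (e (pos e l) k) := by
            by_contra hcon
            have h3 : l.length ≤ N := hN ⟨l, hcon, rfl⟩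
            have h4 := lev_length h _ l hl
            omega
          obtain ⟨k, hk⟩ := this
          exact ⟨k, fun _ => hk⟩
        · exact ⟨0, fun hl' => (hl hl').elim⟩
      choose k hk using h2
      exact ⟨⟨k⟩, fun l hl => (hk l hl).1, mem_iInter₂.2 fun l hl => (hk l hl).2⟩)
  let br := branch fun n => (b n).down
  let f : ℕ → α := fun n => e (pos e (br n)) ((b n).down (br n))
  have hbr : ∀ n, br n ∈ lev h n := by
    intro n
    induction n with
    | zero => simp [br, branch, lev]
    | succ n ih =>
      simp only [lev, mem_iUnion]
      exact ⟨br n, ih, _, hb n _ ih, rfl⟩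
  have hpos : ∀ n, pos e (br n) = List.ofFn fun i : Fin n => f i := by
    intro n
    induction n with
    | zero => simp [br, branch, pos]
    | succ n ih =>
      rw [List.ofFn_succ', List.concat_eq_append]
      simp only [Fin.val_castSucc, Fin.val_last]
      rw [← ih]
      rfl
  refine ⟨f, fun n => ?_, fun y => ?_⟩
  · rw [← hpos]; exact he _ _
  · refine (hby y).mono fun n hn => ?_
    exact mem_iInter₂.1 hn (br n) (hbr n)

/-! ### Omega covers and groupability -/

theorem omega_mk {X : Type u} [TopologicalSpace X] {𝒰 : Set (Set X)}
    (h1 : ∀ U ∈ 𝒰, IsOpen U ∧ U.Nonempty ∧ U ≠ univ)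
    (h2 : ∀ F : Set X, F.Finite → F.Nonempty → ∃ U ∈ 𝒰, F ⊆ U) : 𝒰 ∈ OmegaCovers X := by
  refine ⟨⟨h1, eq_univ_of_forall fun x => ?_⟩, h2⟩
  obtain ⟨U, hU, hx⟩ := h2 {x} (finite_singleton x) (singleton_nonempty x)
  exact ⟨U, hU, hx rfl⟩

theorem gp_mk {X : Type u} [TopologicalSpace X] {C : Set (Set X)}
    (h1 : ∀ U ∈ C, IsOpen U ∧ U.Nonempty ∧ U ≠ univ) (φ : Set X → ℕ)
    (hφ : ∀ n, {U ∈ C | φ U = n}.Finite)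
    (h2 : ∀ F : Set X, F.Finite → F.Nonempty → ∃ N, ∀ n ≥ N, ∃ U ∈ C, φ U = n ∧ F ⊆ U) :
    C ∈ groupables (OmegaCovers X) := by
  refine ⟨omega_mk h1 fun F hF hF' => ?_, φ, hφ, fun J hJ => omega_mk (fun U hU => h1 U hU.1) ?_⟩
  · obtain ⟨N, hN⟩ := h2 F hF hF'
    obtain ⟨U, hU, -, hFU⟩ := hN N le_rfl
    exact ⟨U, hU, hFU⟩
  · intro F hF hF'
    obtain ⟨N, hN⟩ := h2 F hF hF'
    obtain ⟨n, hnJ, hn⟩ := hJ.exists_gt N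
    obtain ⟨U, hU, hUn, hFU⟩ := hN n hn.le
    exact ⟨U, ⟨hU, by rw [hUn]; exact hnJ⟩, hFU⟩

theorem gp_elim {X : Type u} [TopologicalSpace X] {C : Set (Set X)}
    (h : C ∈ groupables (OmegaCovers X)) :
    ∃ φ : Set X → ℕ, (∀ n, {U ∈ C | φ U = n}.Finite) ∧
      ∀ F : Set X, F.Finite → F.Nonempty → ∃ N, ∀ n ≥ N, ∃ U ∈ C, φ U = n ∧ F ⊆ U := by
  obtain ⟨-, φ, hφ, hJ⟩ := h
  refine ⟨φ, hφ, fun F hF hF' => ?_⟩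
  have hfin : {n | ¬ ∃ U ∈ C, φ U = n ∧ F ⊆ U}.Finite := by
    by_contra hinf
    obtain ⟨U, ⟨hUC, hUJ⟩, hFU⟩ := (hJ _ hinf).2 F hF hF'
    exact hUJ ⟨U, hUC, rfl, hFU⟩
  obtain ⟨N, hN⟩ := hfin.bddAbove
  refine ⟨N + 1, fun n hn => ?_⟩
  by_contra hcon
  have := hN hcon
  omega

/-- The set of `K` contained in `U`. -/
def box {X : Type u} (U : Set X) : Set (PFin X) := {K | K.1 ⊆ U}

theorem box_open {X : Type u} [TopologicalSpace X] {U : Set X} (hU : IsOpen U) :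
    IsOpen (box U) :=
  TopologicalSpace.isOpen_generateFrom_of_mem ⟨U, hU, Or.inl rfl⟩

/-- Singleton as a point of the hyperspace. -/
def sing {X : Type u} (x : X) : PFin X := ⟨{x}, finite_singleton x, singleton_nonempty x⟩

theorem box_subset {X : Type u} {U V : Set X} (h : box U ⊆ box V) : U ⊆ V := by
  intro x hx
  have : sing x ∈ box V := h (show ({x} : Set X) ⊆ U from singleton_subset_iff.2 hx)
  exact this rfl

theorem box_injective {X : Type u} : Function.Injective (box (X := X)) := fun _ _ h =>
  Subset.antisymm (box_subset h.subset) (box_subset h.superset)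

theorem box_univ {X : Type u} : box (univ : Set X) = univ :=
  eq_univ_of_forall fun K => subset_univ K.1

/-! ### Transfer of covering properties from `X` -/

theorem transfer {X : Type u} [TopologicalSpace X] [T2Space X] [Infinite X]
    (hS : Sone (OmegaCovers X) (groupables (OmegaCovers X)))
    {Z : Type u} [TopologicalSpace Z] [Nonempty Z] (r : Z → Set X)
    (hr : ∀ z, (r z).Finite ∧ (r z).Nonempty)
    (hfin : ∀ F : Set X, F.Finite → {z | r z ⊆ F}.Finite)
    (htube : ∀ F : Set X, F.Finite → ∀ W : Set Z, IsOpen W → {z | r z ⊆ F} ⊆ W →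
      ∃ U, IsOpen U ∧ F ⊆ U ∧ {z | r z ⊆ U} ⊆ W) :
    GerlitsNagyProp Z := by
  classical
  have htube' : ∀ F : Set X, F.Finite → ∀ W : Set Z, IsOpen W → {z | r z ⊆ F} ⊆ W →
      ∃ U, (IsOpen U ∧ U ≠ univ) ∧ F ⊆ U ∧ {z | r z ⊆ U} ⊆ W := by
    intro F hF W hW hFW
    obtain ⟨U, hU, hFU, hUW⟩ := htube F hF W hW hFW
    obtain ⟨x, hx⟩ := hF.exists_notMem
    refine ⟨U ∩ {x}ᶜ, ⟨hU.inter isOpen_compl_singleton, ?_⟩, ?_, ?_⟩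
    · intro h
      have : x ∈ U ∩ {x}ᶜ := by rw [h]; trivial
      exact this.2 rfl
    · intro y hy
      exact ⟨hFU hy, fun h => hx (by rw [← mem_singleton_iff.1 h]; exact hy)⟩
    · exact fun z hz => hUW (Subset.trans hz inter_subset_left)
  constructor
  · intro 𝒲 h𝒲
    obtain ⟨f, hf, hgp⟩ := hS (fun k => {U | (IsOpen U ∧ U.Nonempty ∧ U ≠ univ) ∧
        ∀ j ≤ k, ∃ ℱ ⊆ 𝒲 j, ℱ.Finite ∧ {z | r z ⊆ U} ⊆ ⋃₀ ℱ}) (by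
      intro k
      refine omega_mk (fun U hU => hU.1) fun F hF hF' => ?_
      have h1 : ∀ j, ∃ ℱ ⊆ 𝒲 j, ℱ.Finite ∧ {z | r z ⊆ F} ⊆ ⋃₀ ℱ := by
        intro j
        have h2 : ∀ z : Z, ∃ w ∈ 𝒲 j, z ∈ w := fun z => by
          have : z ∈ ⋃₀ 𝒲 j := by rw [(h𝒲 j).2]; trivial
          exact this
        choose w hw hzw using h2
        refine ⟨w '' {z | r z ⊆ F}, ?_, (hfin F hF).image _, fun z hz => ?_⟩
        · rintro _ ⟨z, -, rfl⟩; exact hw z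
        · exact ⟨w z, mem_image_of_mem _ hz, hzw z⟩
      choose ℱ h1 h2 h3 using h1
      obtain ⟨U, ⟨hU, hUu⟩, hFU, hUW⟩ := htube' F hF (⋂ j ∈ Set.Iic k, ⋃₀ ℱ j)
        ((Set.finite_Iic k).isOpen_biInter fun j _ =>
          isOpen_sUnion fun w hw => ((h𝒲 j).1 w (h1 j hw)).1)
        (fun z hz => mem_iInter₂.2 fun j _ => h3 j hz)
      exact ⟨U, ⟨⟨hU, hF'.mono hFU, hUu⟩, fun j hj => ⟨ℱ j, h1 j, h2 j, fun z hz =>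
        mem_iInter₂.1 (hUW hz) j hj⟩⟩, hFU⟩)
    obtain ⟨φ, hφ, hcov⟩ := gp_elim hgp
    have hN : ∀ j, ∃ N ≥ j, ∀ k < j, φ (f k) < N := by
      intro j
      obtain ⟨N, hN⟩ := ((Set.finite_lt_nat j).image fun k => φ (f k)).bddAbove
      refine ⟨max j (N + 1), le_max_left _ _, fun k hk => ?_⟩
      have : φ (f k) ≤ N := hN ⟨k, hk, rfl⟩
      exact lt_of_lt_of_le (Nat.lt_succ_of_le this) (le_max_right _ _)
    choose N hNj hN using hN
    have hG : ∀ j, ∃ ℱ ⊆ 𝒲 j, ℱ.Finite ∧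
        ∀ U ∈ Set.range f, φ U = N j → {z | r z ⊆ U} ⊆ ⋃₀ ℱ := by
      intro j
      have h1 : ∀ U : Set X, ∃ ℱ ⊆ 𝒲 j, ℱ.Finite ∧
          (U ∈ Set.range f → φ U = N j → {z | r z ⊆ U} ⊆ ⋃₀ ℱ) := by
        intro U
        by_cases hU : U ∈ Set.range f ∧ φ U = N j
        · obtain ⟨⟨k, rfl⟩, hk⟩ := hU
          have hjk : j ≤ k := by
            by_contra hlt
            have := hN j k (not_le.1 hlt)
            omega
          obtain ⟨ℱ, h1, h2, h3⟩ := (hf k).2 j hjk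
          exact ⟨ℱ, h1, h2, fun _ _ => h3⟩
        · exact ⟨∅, empty_subset _, finite_empty, fun h1 h2 => (hU ⟨h1, h2⟩).elim⟩
      choose ℱ h1 h2 h3 using h1
      refine ⟨⋃ U ∈ {U ∈ Set.range f | φ U = N j}, ℱ U, iUnion₂_subset fun U _ => h1 U,
        (hφ (N j)).biUnion fun U _ => h2 U, fun U hU hUN z hz => ?_⟩
      obtain ⟨w, hw, hzw⟩ := h3 U hU hUN hz
      exact ⟨w, mem_iUnion₂.2 ⟨U, ⟨hU, hUN⟩, hw⟩, hzw⟩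
    choose ℱ h1 h2 h3 using hG
    refine ⟨ℱ, fun n => ⟨h1 n, h2 n⟩, fun z => ?_⟩
    obtain ⟨m, hm⟩ := hcov (r z) (hr z).1 (hr z).2
    refine ⟨m, fun n hn => ?_⟩
    obtain ⟨U, hU, hUN, hzU⟩ := hm (N n) (le_trans hn (hNj n))
    exact h3 n U hU hUN hzU
  · intro 𝒲 h𝒲
    have h2 : ∀ k, ∀ z : Z, ∃ w ∈ 𝒲 k, z ∈ w := fun k z => by
      have : z ∈ ⋃₀ 𝒲 k := by rw [(h𝒲 k).2]; trivial
      exact this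
    obtain ⟨f, hf, hgp⟩ := hS (fun m => {U | (IsOpen U ∧ U.Nonempty ∧ U ≠ univ) ∧
        ∃ w : ℕ → Set Z, (∀ i, w i ∈ 𝒲 (Nat.pair m i)) ∧ {z | r z ⊆ U} ⊆ ⋃ i, w i}) (by
      intro m
      refine omega_mk (fun U hU => hU.1) fun F hF hF' => ?_
      obtain ⟨g, hg⟩ := Set.countable_iff_exists_subset_range.1 (hfin F hF).countable
      choose w hw hzw using fun i => h2 (Nat.pair m i) (g i)
      obtain ⟨U, ⟨hU, hUu⟩, hFU, hUW⟩ := htube' F hF (⋃ i, w i)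
        (isOpen_iUnion fun i => ((h𝒲 _).1 _ (hw i)).1) (fun z hz => by
          obtain ⟨i, rfl⟩ := hg hz
          exact mem_iUnion.2 ⟨i, hzw i⟩)
      exact ⟨U, ⟨⟨hU, hF'.mono hFU, hUu⟩, w, hw, hUW⟩, hFU⟩)
    choose hf0 w hw hfw using hf
    have hmem : ∀ n, w n.unpair.1 n.unpair.2 ∈ 𝒲 n := fun n => by
      have := hw n.unpair.1 n.unpair.2
      rwa [Nat.pair_unpair] at this
    refine ⟨fun n => w n.unpair.1 n.unpair.2, hmem, ?_, eq_univ_of_forall fun z => ?_⟩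
    · rintro _ ⟨n, rfl⟩
      exact (h𝒲 n).1 _ (hmem n)
    · obtain ⟨_, ⟨m, rfl⟩, hm⟩ := hgp.1.2 (r z) (hr z).1 (hr z).2
      obtain ⟨i, hi⟩ := mem_iUnion.1 (hfw m hm)
      exact ⟨w m i, ⟨Nat.pair m i, by simp⟩, hi⟩

/-! ### Tube lemmas -/

theorem vietoris_nhd {X : Type u} [TopologicalSpace X] {W : Set (PFin X)} (hW : IsOpen W) :
    ∀ G ∈ W, ∃ v : X → Set X, (∀ x, IsOpen (v x) ∧ x ∈ v x) ∧
      ∀ K : PFin X, (∀ y ∈ K.1, ∃ x ∈ G.1, y ∈ v x) → (∀ x ∈ G.1, (K.1 ∩ v x).Nonempty) →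
        K ∈ W := by
  classical
  have hW' : TopologicalSpace.GenerateOpen _ W := hW
  induction hW' with
  | basic S hS =>
    intro G hG
    obtain ⟨U, hU, h⟩ := hS
    refine ⟨fun x => if x ∈ U then U else univ, fun x => ?_, fun K h1 h2 => ?_⟩
    · by_cases hx : x ∈ U <;> simp [hx, hU]
    · rcases h with rfl | rfl
      · intro y hy
        obtain ⟨x, hx, hyx⟩ := h1 y hy
        have : x ∈ U := hG hx
        simpa [this] using hyx
      · obtain ⟨x, hx, hxU⟩ := hG
        have := h2 x hx
        simpa [hxU] using this
  | univ => exact fun G _ => ⟨fun _ => univ, by simp, fun _ _ _ => trivial⟩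
  | inter s t hs ht ihs iht =>
    intro G hG
    obtain ⟨v, hv, hv'⟩ := ihs hs G hG.1
    obtain ⟨w, hw, hw'⟩ := iht ht G hG.2
    refine ⟨fun x => v x ∩ w x, fun x => ⟨(hv x).1.inter (hw x).1, (hv x).2, (hw x).2⟩,
      fun K h1 h2 => ⟨hv' K ?_ ?_, hw' K ?_ ?_⟩⟩
    · exact fun y hy => let ⟨x, hx, h⟩ := h1 y hy; ⟨x, hx, h.1⟩
    · exact fun x hx => (h2 x hx).mono (inter_subset_inter_right _ inter_subset_left)
    · exact fun y hy => let ⟨x, hx, h⟩ := h1 y hy; ⟨x, hx, h.2⟩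
    · exact fun x hx => (h2 x hx).mono (inter_subset_inter_right _ inter_subset_right)
  | sUnion 𝒮 h𝒮 ih =>
    rintro G ⟨S, hS, hG⟩
    obtain ⟨v, hv, hv'⟩ := ih S hS (h𝒮 S hS) G hG
    exact ⟨v, hv, fun K h1 h2 => ⟨S, hS, hv' K h1 h2⟩⟩

theorem pfin_fin {X : Type u} (F : Set X) (hF : F.Finite) : {K : PFin X | K.1 ⊆ F}.Finite := by
  refine Set.Finite.of_finite_image (f := Subtype.val) (hF.finite_subsets.subset ?_)
    Subtype.val_injective.injOn
  rintro _ ⟨K, hK, rfl⟩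
  exact hK

theorem pfin_tube {X : Type u} [TopologicalSpace X] (F : Set X) (hF : F.Finite)
    (W : Set (PFin X)) (hW : IsOpen W) (hFW : {K : PFin X | K.1 ⊆ F} ⊆ W) :
    ∃ U, IsOpen U ∧ F ⊆ U ∧ {K : PFin X | K.1 ⊆ U} ⊆ W := by
  have h1 : ∀ G : {K : PFin X | K.1 ⊆ F}, _ := fun G => vietoris_nhd hW G.1 (hFW G.2)
  choose v hv hv' using h1
  have : Finite {K : PFin X | K.1 ⊆ F} := (pfin_fin F hF).to_subtype
  refine ⟨⋃ x ∈ F, ⋂ G, v G x, isOpen_biUnion fun x _ => isOpen_iInter_of_finite fun G => (hv G x).1,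
    fun x hx => mem_iUnion₂.2 ⟨x, hx, mem_iInter.2 fun G => (hv G x).2⟩, fun K hK => ?_⟩
  let G0 : Set X := {x ∈ F | (K.1 ∩ ⋂ G, v G x).Nonempty}
  have hcov : ∀ y ∈ K.1, ∃ x ∈ G0, y ∈ ⋂ G, v G x := by
    intro y hy
    obtain ⟨x, hx, hyx⟩ := mem_iUnion₂.1 (hK hy)
    exact ⟨x, ⟨hx, y, hy, hyx⟩, hyx⟩
  have hne : G0.Nonempty := by
    obtain ⟨y, hy⟩ := K.2.2
    obtain ⟨x, hx, -⟩ := hcov y hy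
    exact ⟨x, hx⟩
  let G : PFin X := ⟨G0, hF.subset (sep_subset _ _), hne⟩
  have hG : G ∈ {K : PFin X | K.1 ⊆ F} := sep_subset _ _
  refine hv' ⟨G, hG⟩ K ?_ ?_
  · intro y hy
    obtain ⟨x, hx, hyx⟩ := hcov y hy
    exact ⟨x, hx, mem_iInter.1 hyx _⟩
  · rintro x ⟨hx, y, hy, hyx⟩
    exact ⟨y, hy, mem_iInter.1 hyx _⟩

theorem pow_fin {X : Type u} (n : ℕ) (F : Set X) (hF : F.Finite) :
    {f : Fin n → X | Set.range f ⊆ F}.Finite := by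
  refine (Set.Finite.pi' fun _ : Fin n => hF).subset fun f hf i => hf ⟨i, rfl⟩

theorem pow_tube {X : Type u} [TopologicalSpace X] (n : ℕ) (F : Set X) (hF : F.Finite)
    (W : Set (Fin n → X)) (hW : IsOpen W) (hFW : {f : Fin n → X | Set.range f ⊆ F} ⊆ W) :
    ∃ U, IsOpen U ∧ F ⊆ U ∧ {f : Fin n → X | Set.range f ⊆ U} ⊆ W := by
  have h1 : ∀ f : {f : Fin n → X | Set.range f ⊆ F}, ∃ u : Fin n → Set X,
      (∀ i, IsOpen (u i) ∧ f.1 i ∈ u i) ∧ Set.univ.pi u ⊆ W :=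
    fun f => isOpen_pi_iff'.1 hW f.1 (hFW f.2)
  choose u hu huW using h1
  have : Finite {f : Fin n → X | Set.range f ⊆ F} := (pow_fin n F hF).to_subtype
  let T : X → Set X := fun x => ⋂ f, ⋂ i, {z | f.1 i = x → z ∈ u f i}
  have hT : ∀ x, IsOpen (T x) := by
    intro x
    refine isOpen_iInter_of_finite fun f => isOpen_iInter_of_finite fun i => ?_
    by_cases hx : f.1 i = x
    · convert (hu f i).1 using 1
      ext z
      simp [hx]
    · simp [hx]
  refine ⟨⋃ x ∈ F, T x, isOpen_biUnion fun x _ => hT x, fun x hx => mem_iUnion₂.2 ⟨x, hx, ?_⟩,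
    fun g hg => ?_⟩
  · refine mem_iInter.2 fun f => mem_iInter.2 fun i hi => ?_
    rw [← hi]
    exact (hu f i).2
  · have h2 : ∀ i, ∃ x ∈ F, g i ∈ T x := fun i => by
      obtain ⟨x, hx, h⟩ := mem_iUnion₂.1 (hg ⟨i, rfl⟩)
      exact ⟨x, hx, h⟩
    choose f hf hgf using h2
    have hfF : Set.range f ⊆ F := by rintro _ ⟨i, rfl⟩; exact hf i
    refine huW ⟨f, hfF⟩ fun i _ => ?_
    exact mem_iInter.1 (mem_iInter.1 (hgf i) ⟨f, hfF⟩) i rfl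

/-! ### From powers to the hyperspace -/

/-- The range map from a power to the hyperspace. -/
def rangeMap {X : Type u} (p : ℕ) (f : Fin (p + 1) → X) : PFin X :=
  ⟨Set.range f, Set.finite_range f, Set.range_nonempty f⟩

theorem rangeMap_continuous {X : Type u} [TopologicalSpace X] (p : ℕ) :
    Continuous (rangeMap (X := X) p) := by
  refine continuous_generateFrom_iff.2 ?_
  rintro S ⟨U, hU, rfl | rfl⟩
  · have : rangeMap p ⁻¹' {K : PFin X | K.1 ⊆ U} = ⋂ i, (fun f : Fin (p + 1) → X => f i) ⁻¹' U := by
      ext f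
      simp [rangeMap, Set.range_subset_iff]
    rw [this]
    exact isOpen_iInter_of_finite fun i => hU.preimage (continuous_apply i)
  · have : rangeMap p ⁻¹' {K : PFin X | (K.1 ∩ U).Nonempty} =
        ⋃ i, (fun f : Fin (p + 1) → X => f i) ⁻¹' U := by
      ext f
      simp [rangeMap, Set.Nonempty]
    rw [this]
    exact isOpen_iUnion fun i => hU.preimage (continuous_apply i)

theorem rangeMap_surj {X : Type u} (K : PFin X) : ∃ p f, rangeMap (X := X) p f = K := by
  have : Finite K.1 := K.2.1.to_subtype
  obtain ⟨n, ⟨e⟩⟩ := Finite.exists_equiv_fin K.1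
  obtain ⟨x, hx⟩ := K.2.2
  cases n with
  | zero => exact (e ⟨x, hx⟩).elim0
  | succ p =>
    refine ⟨p, fun i => (e.symm i).1, Subtype.ext ?_⟩
    ext y
    constructor
    · rintro ⟨i, rfl⟩; exact (e.symm i).2
    · intro hy; exact ⟨e ⟨y, hy⟩, by simp⟩

theorem hurI_union {Y : Type u} [TopologicalSpace Y] {Z : ℕ → Type u}
    [∀ p, TopologicalSpace (Z p)] (q : ∀ p, Z p → Y) (hq : ∀ p, Continuous (q p))
    (hs : ∀ y, ∃ p z, q p z = y) (hZ : ∀ p, HurI (Z p)) : HurI Y := by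
  intro V hV hc
  have h1 : ∀ p, ∃ h : ℕ → ℕ, ∀ z : Z p, ∃ m, ∀ n ≥ m, ∃ k < h n, q p z ∈ V n k := fun p =>
    hZ p (fun n k => q p ⁻¹' V n k) (fun n k => (hV n k).preimage (hq p)) (fun n z => hc n _)
  choose h hh using h1
  refine ⟨fun n => (Finset.range (n + 1)).sup fun p => h p n, fun y => ?_⟩
  obtain ⟨p, z, rfl⟩ := hs y
  obtain ⟨m, hm⟩ := hh p z
  refine ⟨max m p, fun n hn => ?_⟩
  obtain ⟨k, hk, hy⟩ := hm n (le_trans (le_max_left _ _) hn)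
  refine ⟨k, lt_of_lt_of_le hk ?_, hy⟩
  refine Finset.le_sup (f := fun p => h p n) (Finset.mem_range.2 ?_)
  exact Nat.lt_succ_of_le (le_trans (le_max_right _ _) hn)

theorem rothI_union {Y : Type u} [TopologicalSpace Y] {Z : ℕ → Type u}
    [∀ p, TopologicalSpace (Z p)] (q : ∀ p, Z p → Y) (hq : ∀ p, Continuous (q p))
    (hs : ∀ y, ∃ p z, q p z = y) (hZ : ∀ p, RothI (Z p)) : RothI Y := by
  intro β A V hV hc
  have h1 : ∀ p, ∃ b : ℕ → β, (∀ n, b n ∈ A (Nat.pair p n)) ∧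
      ∀ z : Z p, ∃ n, q p z ∈ V (Nat.pair p n) (b n) := fun p =>
    hZ p β (fun n => A (Nat.pair p n)) (fun n b => q p ⁻¹' V (Nat.pair p n) b)
      (fun n b hb => (hV _ b hb).preimage (hq p)) (fun n z => hc _ _)
  choose b hb hz using h1
  refine ⟨fun n => b n.unpair.1 n.unpair.2, fun n => ?_, fun y => ?_⟩
  · have := hb n.unpair.1 n.unpair.2
    rwa [Nat.pair_unpair] at this
  · obtain ⟨p, z, rfl⟩ := hs y
    obtain ⟨n, hn⟩ := hz p z
    exact ⟨Nat.pair p n, by simpa using hn⟩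

/-! ### The game -/

theorem not_oneWins {X : Type u} [TopologicalSpace X]
    (hR : RothI (PFin X)) (hH : HurI (PFin X)) :
    ¬ OneWinsGone (OmegaCovers X) (groupables (OmegaCovers X)) := by
  classical
  rintro ⟨σ, hσ, hwin⟩
  obtain ⟨f, hf, hinf⟩ := core_game hR hH (fun s => {U ∈ σ s | U ∉ s}) box
    (fun s U hU => box_open ((hσ s).1.1 U hU.1).1) (by
      intro s K
      have h1 : ∀ V : Set X, ∃ A : Set X, A.Finite ∧ (V ≠ univ → ¬ A ⊆ V) := by
        intro V
        by_cases hV : V = univ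
        · exact ⟨∅, finite_empty, fun h => (h hV).elim⟩
        · obtain ⟨x, hx⟩ := (ne_univ_iff_exists_notMem V).1 hV
          exact ⟨{x}, finite_singleton x, fun _ h => hx (h rfl)⟩
      choose A hA hAV using h1
      obtain ⟨U, hU, hKU⟩ := (hσ s).2 (K.1 ∪ ⋃ V ∈ {V | V ∈ s}, A V)
        (K.2.1.union ((List.finite_toSet s).biUnion fun V _ => hA V))
        (K.2.2.mono subset_union_left)
      refine ⟨U, ⟨hU, fun hUs => ?_⟩, subset_union_left.trans hKU⟩
      refine hAV U ((hσ s).1.1 U hU).2.2 (Subset.trans ?_ hKU)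
      exact Subset.trans (subset_biUnion_of_mem (u := fun V => A V) (show U ∈ {V | V ∈ s} from hUs))
        subset_union_right)
  have hlt : ∀ i n, i < n → f i ≠ f n := by
    intro i n hin heq
    apply (hf n).2
    rw [← heq]
    exact (List.mem_ofFn' _ _).2 ⟨⟨i, hin⟩, rfl⟩
  have hinj : Function.Injective f := by
    intro i n h
    rcases lt_trichotomy i n with hl | hl | hl
    · exact (hlt i n hl h).elim
    · exact hl
    · exact (hlt n i hl h.symm).elim
  refine hwin f (fun n => (hf n).1) ?_
  obtain ⟨h, hh⟩ := hH (fun n k => box (f (n + k)))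
    (fun n k => box_open ((hσ _).1.1 _ (hf _).1).1) (by
      intro n K
      obtain ⟨m, hm, hnm⟩ := (hinf K).exists_gt n
      exact ⟨m - n, by rw [Nat.add_sub_cancel' hnm.le]; exact hm⟩)
  let a : ℕ → ℕ := fun i => Nat.rec 0 (fun _ x => x + h x + 1) i
  have ha : ∀ i, a (i + 1) = a i + h (a i) + 1 := fun i => rfl
  have hmono : StrictMono a := strictMono_nat_of_lt_succ fun i => by rw [ha]; omega
  have hex : ∀ n, ∃ i, n < a (i + 1) := fun n => ⟨n, hmono.le_apply (x := n + 1)⟩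
  let ψ : ℕ → ℕ := fun n => Nat.find (hex n)
  have hψ : ∀ n, n < a (ψ n + 1) := fun n => Nat.find_spec (hex n)
  have hψ' : ∀ n i, a i ≤ n → n < a (i + 1) → ψ n = i := by
    intro n i h1 h2
    refine le_antisymm (Nat.find_min' (hex n) h2) ?_
    by_contra hcon
    have h3 := hψ n
    have h4 : a (ψ n + 1) ≤ a i := hmono.monotone (show ψ n + 1 ≤ i by omega)
    omega
  have hinv : ∀ n, Function.invFun f (f n) = n := Function.leftInverse_invFun hinj
  refine gp_mk ?_ (fun U => ψ (Function.invFun f U)) ?_ ?_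
  · rintro _ ⟨n, rfl⟩
    exact (hσ _).1.1 _ (hf n).1
  · intro n
    refine ((Set.finite_lt_nat (a (n + 1))).image f).subset ?_
    rintro _ ⟨⟨k, rfl⟩, hk⟩
    rw [hinv] at hk
    exact ⟨k, by rw [← hk]; exact hψ k, rfl⟩
  · intro F hF hF'
    obtain ⟨m, hm⟩ := hh ⟨F, hF, hF'⟩
    refine ⟨m, fun n hn => ?_⟩
    obtain ⟨k, hk, hFk⟩ := hm (a n) (le_trans hn hmono.le_apply)
    refine ⟨f (a n + k), ⟨_, rfl⟩, ?_, hFk⟩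
    rw [hinv]
    exact hψ' _ _ (by omega) (by rw [ha]; omega)

theorem sone_of_game {X : Type u} [TopologicalSpace X]
    (h : ¬ OneWinsGone (OmegaCovers X) (groupables (OmegaCovers X))) :
    Sone (OmegaCovers X) (groupables (OmegaCovers X)) := by
  intro 𝒰 h𝒰
  by_contra hcon
  push Not at hcon
  refine h ⟨fun s => 𝒰 s.length, fun s => h𝒰 _, fun f hf => hcon f fun n => ?_⟩
  simpa using hf n

theorem sone_pfin_of_game {X : Type u} [TopologicalSpace X] [Nonempty X]
    (h : ¬ OneWinsGone (OmegaCovers X) (groupables (OmegaCovers X))) :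
    Sone (OmegaCovers (PFin X)) (groupables (OmegaCovers (PFin X))) := by
  classical
  intro 𝒲 h𝒲
  have hc : ∀ (k : ℕ) (U : Set X), ∃ W : Set (PFin X), W ≠ univ ∧
      ((∃ W ∈ 𝒲 k, box U ⊆ W) → W ∈ 𝒲 k ∧ box U ⊆ W) := by
    intro k U
    by_cases hW : ∃ W ∈ 𝒲 k, box U ⊆ W
    · obtain ⟨W, hW, hUW⟩ := hW
      exact ⟨W, ((h𝒲 k).1.1 W hW).2.2, fun _ => ⟨hW, hUW⟩⟩
    · have : Nonempty (PFin X) := ⟨sing (Classical.arbitrary X)⟩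
      exact ⟨∅, Set.empty_ne_univ, fun h => (hW h).elim⟩
  choose c hcu hc using hc
  let σ : List (Set X) → Set (Set X) := fun s =>
    {U | (IsOpen U ∧ U.Nonempty ∧ U ≠ univ) ∧ (∃ W ∈ 𝒲 s.length, box U ⊆ W) ∧
      ∀ i : Fin s.length, ¬ box U ⊆ c i (s.get i)}
  have hσ : ∀ s, σ s ∈ OmegaCovers X := by
    intro s
    refine omega_mk (fun U hU => hU.1) fun F hF hF' => ?_
    choose y hy using fun i : Fin s.length =>
      (ne_univ_iff_exists_notMem _).1 (hcu i (s.get i))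
    have hF2 : (F ∪ ⋃ i, (y i).1).Finite := hF.union (Set.finite_iUnion fun i => (y i).2.1)
    have hF2' : (F ∪ ⋃ i, (y i).1).Nonempty := hF'.mono subset_union_left
    obtain ⟨W, hW, hFW⟩ := (h𝒲 s.length).2 {K : PFin X | K.1 ⊆ F ∪ ⋃ i, (y i).1}
      (pfin_fin _ hF2) ⟨⟨_, hF2, hF2'⟩, Subset.rfl⟩
    obtain ⟨U, hU, hFU, hUW⟩ := pfin_tube _ hF2 W ((h𝒲 _).1.1 W hW).1 hFW
    refine ⟨U, ⟨⟨hU, hF2'.mono hFU, ?_⟩, ⟨W, hW, hUW⟩, fun i hi => ?_⟩,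
      subset_union_left.trans hFU⟩
    · rintro rfl
      apply ((h𝒲 _).1.1 W hW).2.2
      exact univ_subset_iff.1 (fun K _ => hUW (subset_univ K.1))
    · refine hy i (hi ?_)
      exact Subset.trans (Subset.trans (subset_iUnion (fun i => (y i).1) i) subset_union_right) hFU
  have : ∃ f : ℕ → Set X, (∀ n, f n ∈ σ (List.ofFn fun i : Fin n => f i)) ∧
      Set.range f ∈ groupables (OmegaCovers X) := by
    by_contra hcon
    push Not at hcon
    exact h ⟨σ, hσ, hcon⟩
  obtain ⟨f, hf, hgp⟩ := this
  let W : ℕ → Set (PFin X) := fun n => c n (f n)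
  have hW : ∀ n, W n ∈ 𝒲 n ∧ box (f n) ⊆ W n := by
    intro n
    apply hc
    simpa using (hf n).2.1
  have hnew : ∀ i n, i < n → ¬ box (f n) ⊆ W i := by
    intro i n hin
    have := (hf n).2.2 ⟨i, by simpa using hin⟩
    simpa using this
  have hinj : Function.Injective W := by
    intro i n hin
    rcases lt_trichotomy i n with hl | hl | hl
    · exact (hnew i n hl (by rw [hin]; exact (hW n).2)).elim
    · exact hl
    · exact (hnew n i hl (by rw [← hin]; exact (hW i).2)).elim
  have hfinj : Function.Injective f := by
    intro i n hin
    rcases lt_trichotomy i n with hl | hl | hl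
    · exact (hnew i n hl (by rw [← hin]; exact (hW i).2)).elim
    · exact hl
    · exact (hnew n i hl (by rw [hin]; exact (hW n).2)).elim
  have hinv : ∀ n, Function.invFun W (W n) = n := Function.leftInverse_invFun hinj
  refine ⟨W, fun n => (hW n).1, ?_⟩
  obtain ⟨φ, hφ, hcov⟩ := gp_elim hgp
  refine gp_mk ?_ (fun S => φ (f (Function.invFun W S))) ?_ ?_
  · rintro _ ⟨n, rfl⟩
    exact (h𝒲 n).1.1 _ (hW n).1
  · intro n
    refine (((hφ n).preimage hfinj.injOn).image W).subset ?_
    rintro _ ⟨⟨k, rfl⟩, hk⟩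
    rw [hinv] at hk
    exact ⟨k, ⟨⟨k, rfl⟩, hk⟩, rfl⟩
  · intro A hA hA'
    obtain ⟨N, hN⟩ := hcov (⋃ K ∈ A, K.1) (hA.biUnion fun K _ => K.2.1) (by
      obtain ⟨K, hK⟩ := hA'
      exact K.2.2.mono (subset_biUnion_of_mem (u := fun K : PFin X => K.1) hK))
    refine ⟨N, fun n hn => ?_⟩
    obtain ⟨_, ⟨k, rfl⟩, hk, hAk⟩ := hN n hn
    refine ⟨W k, ⟨k, rfl⟩, by rw [hinv]; exact hk, fun K hK => (hW k).2 ?_⟩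
    exact Subset.trans (subset_biUnion_of_mem (u := fun K : PFin X => K.1) hK) hAk

theorem sone_of_pfin {X : Type u} [TopologicalSpace X]
    (h : Sone (OmegaCovers (PFin X)) (groupables (OmegaCovers (PFin X)))) :
    Sone (OmegaCovers X) (groupables (OmegaCovers X)) := by
  intro 𝒰 h𝒰
  obtain ⟨g, hg, hgp⟩ := h (fun n => box '' 𝒰 n) (by
    intro n
    refine omega_mk ?_ fun A hA hA' => ?_
    · rintro _ ⟨U, hU, rfl⟩
      obtain ⟨h1, ⟨x, hx⟩, h3⟩ := (h𝒰 n).1.1 U hU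
      refine ⟨box_open h1, ⟨sing x, ?_⟩, fun hb => h3 ?_⟩
      · exact singleton_subset_iff.2 hx
      · exact box_injective (hb.trans box_univ.symm)
    · obtain ⟨U, hU, hAU⟩ := (h𝒰 n).2 (⋃ K ∈ A, K.1) (hA.biUnion fun K _ => K.2.1) (by
        obtain ⟨K, hK⟩ := hA'
        exact K.2.2.mono (subset_biUnion_of_mem (u := fun K : PFin X => K.1) hK))
      refine ⟨box U, ⟨U, hU, rfl⟩, fun K hK => ?_⟩
      exact Subset.trans (subset_biUnion_of_mem (u := fun K : PFin X => K.1) hK) hAU)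
  choose f hf hfg using hg
  obtain ⟨φ, hφ, hcov⟩ := gp_elim hgp
  refine ⟨f, hf, gp_mk ?_ (fun U => φ (box U)) ?_ ?_⟩
  · rintro _ ⟨n, rfl⟩
    exact (h𝒰 n).1.1 _ (hf n)
  · intro n
    refine ((hφ n).preimage box_injective.injOn).subset ?_
    rintro _ ⟨⟨k, rfl⟩, hk⟩
    exact ⟨⟨k, (hfg k).symm⟩, hk⟩
  · intro F hF hF'
    obtain ⟨N, hN⟩ := hcov {⟨F, hF, hF'⟩} (finite_singleton _) (singleton_nonempty _)
    refine ⟨N, fun n hn => ?_⟩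
    obtain ⟨_, ⟨k, rfl⟩, hk, hFk⟩ := hN n hn
    rw [← hfg] at hk hFk
    exact ⟨f k, ⟨k, rfl⟩, hk, hFk rfl⟩

theorem statement11 {X : Type u} [TopologicalSpace X] [T2Space X] [Infinite X] :
    List.TFAE
      [GerlitsNagyProp (PFin X),
       Sone (OmegaCovers (PFin X)) (groupables (OmegaCovers (PFin X))),
       Sone (OmegaCovers X) (groupables (OmegaCovers X)),
       ∀ n : ℕ, 1 ≤ n → GerlitsNagyProp (Fin n → X),
       ¬ OneWinsGone (OmegaCovers X) (groupables (OmegaCovers X))] := by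


  have : Nonempty (PFin X) := ⟨sing (Classical.arbitrary X)⟩
  tfae_have 1 → 5 := fun h => not_oneWins (rothI_of_prop h.2) (hurI_of_prop h.1)
  tfae_have 4 → 5 := fun h => not_oneWins
    (rothI_union (fun p => rangeMap p) rangeMap_continuous rangeMap_surj
      fun p => rothI_of_prop (h (p + 1) (Nat.succ_pos p)).2)
    (hurI_union (fun p => rangeMap p) rangeMap_continuous rangeMap_surj
      fun p => hurI_of_prop (h (p + 1) (Nat.succ_pos p)).1)
  tfae_have 5 → 3 := sone_of_game
  tfae_have 5 → 2 := sone_pfin_of_game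
  tfae_have 2 → 3 := sone_of_pfin
  tfae_have 3 → 1 := fun h => transfer h (fun K : PFin X => K.1) (fun K => K.2) pfin_fin pfin_tube
  tfae_have 3 → 4 := fun h n hn => by
    have : Nonempty (Fin n) := ⟨⟨0, hn⟩⟩
    exact transfer h (fun f : Fin n → X => Set.range f)
      (fun f => ⟨Set.finite_range f, Set.range_nonempty f⟩) (pow_fin n) (pow_tube n)
  tfae_finish
end

section
/- Let X be a non-compact Tychonoff space. The following are equivalent: (i) X satisfies S_1(𝒦_X, 𝒦_X^gp); (ii) One does not have a winning strategy in the game G_1(𝒦_X, 𝒦_X^gp); (iii) C_k(X) is Reznichenko and has countable strong fan-tightness; (iv) C_k(X) satisfies S_1(Ω_{C_k(X),𝟎}, Ω_{C_k(X),𝟎}^gp). -/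
open Set TopologicalSpace

universe u

open Filter Topology

namespace S17

/-- Abstract covers. -/
def Cov {ι : Type*} {α : Type u} (R : ι → α → Prop) (G : α → Prop) : Set (Set α) :=
  {A | (∀ a ∈ A, G a) ∧ ∀ p, ∃ a ∈ A, R p a}

/-- Separation hypothesis. -/
def Sep {ι : Type*} {α : Type u} (R : ι → α → Prop) (G : α → Prop) : Prop :=
  ∀ a, G a → ∀ p, ∃ q, ¬ R q a ∧ ∀ b, R q b → R p b

/-- Hurewicz type selection. -/
def Hp {ι : Type*} {α : Type u} (R : ι → α → Prop) (G : α → Prop) : Prop :=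
  ∀ 𝒰 : ℕ → Set α, (∀ n, 𝒰 n ∈ Cov R G) →
    ∃ F : ℕ → Set α, (∀ n, F n ⊆ 𝒰 n ∧ (F n).Finite) ∧ ∀ p, ∀ᶠ n in atTop, ∃ a ∈ F n, R p a

/-- Weak grouping. -/
def Wp {ι : Type*} {α : Type u} (R : ι → α → Prop) (G : α → Prop) : Prop :=
  ∀ 𝒰 : ℕ → Set α, (∀ n, 𝒰 n ∈ Cov R G) →
    ∃ V : ℕ → α, (∀ n, V n ∈ 𝒰 n) ∧ ∃ N : ℕ → Set ℕ, (∀ k, (N k).Finite) ∧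
      (∀ m, ∀ᶠ k in atTop, ∀ n ∈ N k, m ≤ n) ∧ ∀ p, ∀ᶠ k in atTop, ∃ n ∈ N k, R p (V n)

section abs
variable {ι : Type*} {α : Type u} {R : ι → α → Prop} {G : α → Prop}

lemma cov_diff (hs : Sep R G) {A : Set α} (hA : A ∈ Cov R G) {E : Set α} (hE : E.Finite) :
    A \ E ∈ Cov R G := by
  induction E, hE using Set.Finite.induction_on with
  | empty => simpa using hA
  | @insert a E _ _ ih =>
    refine ⟨fun b hb => hA.1 b hb.1, fun p => ?_⟩
    by_cases ha : G a
    · obtain ⟨q, hq, hqp⟩ := hs a ha p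
      obtain ⟨b, hb, hqb⟩ := ih.2 q
      refine ⟨b, ⟨hb.1, ?_⟩, hqp b hqb⟩
      rintro (rfl | h)
      · exact hq hqb
      · exact hb.2 h
    · obtain ⟨b, hb, hqb⟩ := ih.2 p
      refine ⟨b, ⟨hb.1, ?_⟩, hqb⟩
      rintro (rfl | h)
      · exact ha (hA.1 _ hb.1)
      · exact hb.2 h

lemma groupable_of_Hp (hs : Sep R G) (hH : Hp R G) {A : Set α} (hA : A ∈ Cov R G)
    (hc : A.Countable) : Groupable (Cov R G) A := by
  obtain ⟨e, he⟩ := Set.countable_iff_exists_injOn.1 hc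
  have hfin : ∀ n, {a ∈ A | e a < n}.Finite := fun n =>
    Set.Finite.of_finite_image (f := e) ((Set.finite_lt_nat n).subset (by
      rintro _ ⟨a, ha, rfl⟩; exact ha.2)) (he.mono fun a ha => ha.1)
  obtain ⟨F, hF, hFp⟩ := hH (fun n => A \ {a ∈ A | e a < n}) (fun n => cov_diff hs hA (hfin n))
  have hb : ∀ n, ∃ M, n < M ∧ ∀ a ∈ F n, e a < M := by
    intro n
    obtain ⟨M, hM⟩ := ((hF n).2.image e).bddAbove
    exact ⟨max M n + 1, by omega, fun a ha => by
      have := hM (Set.mem_image_of_mem e ha); omega⟩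
  choose S hS1 hS2 using hb
  let N : ℕ → ℕ := fun i => Nat.rec 0 (fun _ x => S x) i
  have hN1 : ∀ i, N (i+1) = S (N i) := fun i => rfl
  have hNm : StrictMono N := strictMono_nat_of_lt_succ fun i => by rw [hN1]; exact hS1 _
  have hex : ∀ a, ∃ i, e a < N (i+1) := fun a => ⟨e a, lt_of_lt_of_le (Nat.lt_succ_self _) (hNm.id_le _)⟩
  classical
  let φ : α → ℕ := fun a => Nat.find (hex a)
  have hφ : ∀ a i, N i ≤ e a → e a < N (i+1) → φ a = i := by
    intro a i h1 h2
    refine (Nat.find_eq_iff _).2 ⟨h2, fun j hj h => ?_⟩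
    have := hNm.monotone (show j + 1 ≤ i from hj)
    omega
  refine ⟨φ, fun n => (hfin (N (n+1))).subset ?_, fun J hJ => ⟨fun a ha => hA.1 a ha.1, fun p => ?_⟩⟩
  · rintro a ⟨ha, rfl⟩
    exact ⟨ha, Nat.find_spec (hex a)⟩
  · have := hNm.tendsto_atTop.eventually (hFp p)
    obtain ⟨i, hi, a, ha, hpa⟩ := ((Nat.frequently_atTop_iff_infinite.2 hJ).and_eventually this).exists
    have h1 := (hF _).1 ha
    refine ⟨a, ⟨h1.1, ?_⟩, hpa⟩
    rw [hφ a i (by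
      by_contra h
      exact h1.2 ⟨h1.1, by omega⟩) (hS2 _ a ha)]
    exact hi

lemma Wp_of_Sone (h : Sone (Cov R G) (groupables (Cov R G))) : Wp R G := by
  intro 𝒰 h𝒰
  obtain ⟨V, hV, hr, φ, hφ, hJ⟩ := h 𝒰 h𝒰
  refine ⟨V, hV, fun k => {n | (∀ m < n, V m ≠ V n) ∧ φ (V n) = k}, fun k => ?_, fun m => ?_, fun p => ?_⟩
  · refine Set.Finite.of_finite_image (f := V) ((hφ k).subset ?_) ?_
    · rintro _ ⟨n, hn, rfl⟩
      exact ⟨⟨n, rfl⟩, hn.2⟩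
    · intro a ha b hb hab
      rcases lt_trichotomy a b with h | h | h
      · exact absurd hab (hb.1 a h)
      · exact h
      · exact absurd hab.symm (ha.1 b h)
  · have : ∀ᶠ k in atTop, ∀ n ∈ Finset.range m, φ (V n) < k := by
      rw [Filter.eventually_all_finset]
      intro n _
      exact eventually_gt_atTop _
    filter_upwards [this] with k hk n hn
    by_contra hlt
    have := hk n (Finset.mem_range.2 (by omega))
    have := hn.2
    omega
  · by_contra hcon
    rw [Filter.not_eventually, Nat.frequently_atTop_iff_infinite] at hcon
    obtain ⟨a, ⟨⟨n, rfl⟩, hn⟩, hpa⟩ := (hJ _ hcon).2 p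
    apply hn
    classical
    have hex : ∃ m, V m = V n := ⟨n, rfl⟩
    have hsp := Nat.find_spec hex
    refine ⟨Nat.find hex, ⟨fun m hm => ?_, by rw [hsp]⟩, by rw [hsp]; exact hpa⟩
    rw [hsp]
    exact Nat.find_min hex hm

lemma Sone_of_Wp (h : Wp R G) : Sone (Cov R G) (Cov R G) := by
  intro 𝒰 h𝒰
  obtain ⟨V, hV, N, -, -, h3⟩ := h 𝒰 h𝒰
  refine ⟨V, hV, ?_, fun p => ?_⟩
  · rintro _ ⟨n, rfl⟩
    exact (h𝒰 n).1 _ (hV n)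
  · obtain ⟨k, n, _, hn⟩ := (h3 p).exists
    exact ⟨_, ⟨n, rfl⟩, hn⟩

lemma Sone_gp (hs : Sep R G) (hH : Hp R G) (h : Sone (Cov R G) (Cov R G)) :
    Sone (Cov R G) (groupables (Cov R G)) := by
  intro 𝒰 h𝒰
  obtain ⟨V, hV, hr⟩ := h 𝒰 h𝒰
  exact ⟨V, hV, hr, groupable_of_Hp hs hH hr (Set.countable_range V)⟩

end abs

section sets
variable {X : Type u} [TopologicalSpace X]

/-- nonempty compacts -/
abbrev KP (X : Type u) [TopologicalSpace X] := {K : Set X // IsCompact K ∧ K.Nonempty}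
/-- containment -/
def RK (p : KP X) (U : Set X) : Prop := p.1 ⊆ U
/-- admissible sets -/
def GK (U : Set X) : Prop := IsOpen U ∧ U.Nonempty ∧ U ≠ Set.univ

lemma KCovers_eq : KCovers X = Cov (RK (X := X)) GK := by
  ext 𝒰
  constructor
  · rintro ⟨⟨h1, _⟩, h3⟩
    exact ⟨h1, fun p => h3 p.1 p.2.1 p.2.2⟩
  · rintro ⟨h1, h3⟩
    refine ⟨⟨h1, ?_⟩, fun K hK hn => h3 ⟨K, hK, hn⟩⟩
    refine Set.eq_univ_of_forall fun x => ?_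
    obtain ⟨U, hU, hx⟩ := h3 ⟨{x}, isCompact_singleton, Set.singleton_nonempty x⟩
    exact ⟨U, hU, hx rfl⟩

lemma sepK : Sep (RK (X := X)) GK := by
  intro U hU p
  obtain ⟨x, hx⟩ := (Set.ne_univ_iff_exists_notMem U).1 hU.2.2
  refine ⟨⟨insert x p.1, p.2.1.insert x, Set.insert_nonempty _ _⟩, fun h => hx (h (Set.mem_insert _ _)),
    fun b hb => (Set.subset_insert _ _).trans hb⟩

lemma HpK_of_Wp (h : Wp (RK (X := X)) GK) : Hp (RK (X := X)) GK := by
  intro 𝒰 h𝒰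
  obtain ⟨V, hV, N, h1, h2, h3⟩ := h (fun n => {V | GK V ∧ ∀ i ≤ n, ∃ U ∈ 𝒰 i, V ⊆ U}) (by
    intro n
    refine ⟨fun a ha => ha.1, fun p => ?_⟩
    choose U hU hpU using fun i => (h𝒰 i).2 p
    refine ⟨⋂ i ∈ Set.Iic n, U i, ⟨⟨?_, ?_, ?_⟩, ?_⟩, ?_⟩
    · exact (Set.finite_Iic n).isOpen_biInter fun i _ => ((h𝒰 i).1 _ (hU i)).1
    · exact p.2.2.mono (Set.subset_iInter₂ fun i _ => hpU i)
    · intro h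
      apply ((h𝒰 0).1 _ (hU 0)).2.2
      exact Set.eq_univ_of_univ_subset (h ▸ Set.biInter_subset_of_mem (Nat.zero_le n))
    · exact fun i hi => ⟨U i, hU i, Set.biInter_subset_of_mem hi⟩
    · exact Set.subset_iInter₂ fun i _ => hpU i)
  have : ∀ n, ∃ k, n ≤ k ∧ ∀ l ∈ N k, n ≤ l := fun n => ((eventually_ge_atTop n).and (h2 n)).exists
  choose k hk1 hk2 using this
  have : ∀ n l, ∃ U, l ∈ N (k n) → U ∈ 𝒰 n ∧ V l ⊆ U := by
    intro n l
    by_cases hl : l ∈ N (k n)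
    · obtain ⟨U, hU⟩ := (hV l).2 n (hk2 n l hl)
      exact ⟨U, fun _ => hU⟩
    · exact ⟨∅, fun h => absurd h hl⟩
  choose U hU using this
  refine ⟨fun n => U n '' N (k n), fun n => ⟨?_, (h1 _).image _⟩, fun p => ?_⟩
  · rintro _ ⟨l, hl, rfl⟩
    exact (hU n l hl).1
  · have ht : Tendsto k atTop atTop := tendsto_atTop_mono hk1 tendsto_id
    filter_upwards [ht.eventually (h3 p)] with n hn
    obtain ⟨l, hl, hpl⟩ := hn
    exact ⟨_, ⟨l, hl, rfl⟩, Set.Subset.trans hpl (hU n l hl).2⟩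

/-- position reached -/
def pos {α : Type u} (e : List α → ℕ → α) : List ℕ → List α
  | [] => []
  | j :: l => pos e l ++ [e (pos e l) j]

/-- the finitely branching tree (reversed lists) -/
def T (b : List ℕ → ℕ) : ℕ → Set (List ℕ)
  | 0 => {[]}
  | n+1 => {s | ∃ l ∈ T b n, ∃ j ≤ b l, s = j :: l}

lemma T_fin (b : List ℕ → ℕ) (n : ℕ) : (T b n).Finite := by
  induction n with
  | zero => exact Set.finite_singleton _
  | succ n ih =>
    have : T b (n+1) = ⋃ l ∈ T b n, (fun j => j :: l) '' Set.Iic (b l) := by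
      ext s; simp [T]; grind
    rw [this]
    exact ih.biUnion fun l _ => (Set.finite_Iic _).image _

lemma T_len (b : List ℕ → ℕ) (n : ℕ) : ∀ l ∈ T b n, l.length = n := by
  induction n with
  | zero => rintro l rfl; rfl
  | succ n ih =>
    rintro _ ⟨l, hl, j, _, rfl⟩
    simp [ih l hl]

lemma T_ne (b : List ℕ → ℕ) (n : ℕ) : (T b n).Nonempty := by
  induction n with
  | zero => exact ⟨[], rfl⟩
  | succ n ih =>
    obtain ⟨l, hl⟩ := ih
    exact ⟨0 :: l, l, hl, 0, Nat.zero_le _, rfl⟩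

lemma game (hS : Sone (Cov (RK (X := X)) GK) (Cov RK GK)) (hH : Hp (RK (X := X)) GK) :
    ¬ OneWinsGone (Cov (RK (X := X)) GK) (groupables (Cov RK GK)) := by
  rintro ⟨σ, hσ, hwin⟩
  have : ∀ s, ∃ f : ℕ → Set X, (∀ n, f n ∈ σ s) ∧ Set.range f ∈ Cov RK GK :=
    fun s => hS (fun _ => σ s) (fun _ => hσ s)
  choose e he1 he2 using this
  let U : List ℕ → ℕ → Set X := fun l j => e (pos e l) j
  have hUG : ∀ l j, GK (U l j) := fun l j => (he2 _).1 _ ⟨j, rfl⟩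
  -- bound
  obtain ⟨b, hb⟩ : ∃ b : List ℕ → ℕ, ∀ p, {l | ¬ ∃ j ≤ b l, RK p (U l j)}.Finite := by
    let q := Denumerable.eqv (List ℕ)
    obtain ⟨F, hF, hFp⟩ := hH (fun n => Set.range (U (q.symm n))) (fun n => he2 _)
    have : ∀ n, ∃ M, ∀ V ∈ F n, ∃ j ≤ M, V = U (q.symm n) j := by
      intro n
      have h1 : ∀ V : Set X, ∃ j, V ∈ F n → V = U (q.symm n) j := by
        intro V
        by_cases hV : V ∈ F n
        · obtain ⟨j, hj⟩ := (hF n).1 hV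
          exact ⟨j, fun _ => hj.symm⟩
        · exact ⟨0, fun h => absurd h hV⟩
      choose j hj using h1
      obtain ⟨M, hM⟩ := ((hF n).2.image j).bddAbove
      exact ⟨M, fun V hV => ⟨j V, hM ⟨V, hV, rfl⟩, hj V hV⟩⟩
    choose M hM using this
    refine ⟨fun l => M (q l), fun p => ?_⟩
    have h1 : {n | ¬ ∃ a ∈ F n, RK p a}.Finite := by
      have := hFp p
      rw [← Nat.cofinite_eq_atTop] at this
      exact this
    refine Set.Finite.of_finite_image (f := q) (h1.subset ?_) q.injective.injOn
    rintro _ ⟨l, hl, rfl⟩ ⟨V, hV, hpV⟩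
    obtain ⟨j, hj, rfl⟩ := hM _ V hV
    exact hl ⟨j, hj, by simpa using hpV⟩
  -- eventually all nodes are good
  have hgood : ∀ p, ∃ n0, ∀ n ≥ n0, ∃ ψ : List ℕ → ℕ, (∀ l, ψ l ≤ b l) ∧
      ∀ l ∈ T b n, RK p (U l (ψ l)) := by
    intro p
    obtain ⟨M, hM⟩ := ((hb p).image List.length).bddAbove
    refine ⟨M + 1, fun n hn => ?_⟩
    have : ∀ l, ∃ j, j ≤ b l ∧ (l ∈ T b n → RK p (U l j)) := by
      intro l
      by_cases hl : ∃ j ≤ b l, RK p (U l j)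
      · obtain ⟨j, hj, h⟩ := hl
        exact ⟨j, hj, fun _ => h⟩
      · refine ⟨0, Nat.zero_le _, fun hT => ?_⟩
        have h1 := hM ⟨l, hl, rfl⟩
        rw [T_len b n l hT] at h1
        omega
    choose ψ h1 h2 using this
    exact ⟨ψ, h1, h2⟩
  obtain ⟨V, hV, hVr⟩ := hS (fun m => {V | GK V ∧ ∃ S : Finset ℕ, m + 1 ≤ S.card ∧ ∀ n ∈ S,
      ∃ ψ : List ℕ → ℕ, (∀ l, ψ l ≤ b l) ∧ ∀ l ∈ T b n, V ⊆ U l (ψ l)}) (by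
    intro m
    refine ⟨fun a ha => ha.1, fun p => ?_⟩
    obtain ⟨n0, hn0⟩ := hgood p
    have : ∀ n, ∃ ψ : List ℕ → ℕ, n ≥ n0 → (∀ l, ψ l ≤ b l) ∧ ∀ l ∈ T b n, RK p (U l (ψ l)) := by
      intro n
      by_cases hn : n ≥ n0
      · obtain ⟨ψ, h⟩ := hn0 n hn
        exact ⟨ψ, fun _ => h⟩
      · exact ⟨fun _ => 0, fun h => absurd h hn⟩
    choose ψ hψ using this
    let S := Finset.Ico n0 (n0 + (m+1))
    have hSn : ∀ n ∈ S, n ≥ n0 := fun n hn => (Finset.mem_Ico.1 hn).1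
    have hpV : p.1 ⊆ ⋂ n ∈ (S : Set ℕ), ⋂ l ∈ T b n, U l (ψ n l) :=
      Set.subset_iInter₂ fun n hn => Set.subset_iInter₂ fun l hl => (hψ n (hSn n hn)).2 l hl
    have hVs : ∀ n ∈ S, ∀ l ∈ T b n, (⋂ n ∈ (S : Set ℕ), ⋂ l ∈ T b n, U l (ψ n l)) ⊆ U l (ψ n l) :=
      fun n hn l hl => (Set.biInter_subset_of_mem (show n ∈ (S : Set ℕ) from hn)).trans
        (Set.biInter_subset_of_mem hl)
    refine ⟨⋂ n ∈ (S : Set ℕ), ⋂ l ∈ T b n, U l (ψ n l), ⟨⟨?_, p.2.2.mono hpV, ?_⟩, S, ?_, ?_⟩, hpV⟩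
    · exact S.finite_toSet.isOpen_biInter fun n _ => (T_fin b n).isOpen_biInter fun l _ => (hUG _ _).1
    · intro h
      obtain ⟨l, hl⟩ := T_ne b n0
      have := hVs n0 (by simp [S]) l hl
      rw [h] at this
      exact (hUG _ _).2.2 (Set.eq_univ_of_univ_subset this)
    · simp [S]
    · intro n hn
      exact ⟨ψ n, (hψ n (hSn n hn)).1, hVs n hn⟩)
  choose hVG S hSc hSψ using hV
  obtain ⟨n', hinj, hn'⟩ := (Finset.all_card_le_biUnion_card_iff_exists_injective S).1 (by
    intro s
    rcases s.eq_empty_or_nonempty with rfl | hs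
    · simp
    · have hm := s.max'_mem hs
      have h1 : s ⊆ Finset.range (s.max' hs + 1) := fun x hx =>
        Finset.mem_range.2 (Nat.lt_succ_of_le (s.le_max' x hx))
      have h2 := Finset.card_le_card h1
      have h3 := Finset.card_le_card (Finset.subset_biUnion_of_mem S hm)
      have h4 := hSc (s.max' hs)
      simp only [Finset.card_range] at h2
      omega)
  choose ψ hψ1 hψ2 using fun m => hSψ m (n' m) (hn' m)
  let Ψ : ℕ → List ℕ → ℕ := Function.extend n' ψ (fun _ _ => 0)
  have hΨ : ∀ m, Ψ (n' m) = ψ m := fun m => hinj.extend_apply _ _ _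
  have hΨb : ∀ n l, Ψ n l ≤ b l := by
    intro n l
    by_cases h : ∃ m, n' m = n
    · obtain ⟨m, rfl⟩ := h
      rw [hΨ]; exact hψ1 m l
    · have : Ψ n = fun _ => 0 := Function.extend_apply' _ _ _ h
      rw [this]; exact Nat.zero_le _
  let L : ℕ → List ℕ := fun n => Nat.rec [] (fun n l => Ψ n l :: l) n
  have hL : ∀ n, L (n+1) = Ψ n (L n) :: L n := fun n => rfl
  have hLT : ∀ n, L n ∈ T b n := by
    intro n
    induction n with
    | zero => exact rfl
    | succ n ih => exact ⟨L n, ih, Ψ n (L n), hΨb _ _, hL n⟩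
  let f : ℕ → Set X := fun n => U (L n) (Ψ n (L n))
  have hpos : ∀ n, pos e (L n) = List.ofFn fun i : Fin n => f i := by
    intro n
    induction n with
    | zero => rfl
    | succ n ih =>
      rw [hL, pos, List.ofFn_succ_last]
      simp only [Fin.val_castSucc, Fin.val_last]
      rw [← ih]
  have hfr : Set.range f ∈ Cov RK GK := by
    refine ⟨?_, fun p => ?_⟩
    · rintro _ ⟨n, rfl⟩
      exact hUG _ _
    · obtain ⟨_, ⟨m, rfl⟩, hm⟩ := hVr.2 p
      refine ⟨_, ⟨n' m, rfl⟩, Set.Subset.trans hm ?_⟩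
      have := hψ2 m (L (n' m)) (hLT _)
      simp only [f, hΨ]
      exact this
  refine hwin f (fun n => ?_) ⟨hfr, groupable_of_Hp sepK hH hfr (Set.countable_range f)⟩
  rw [← hpos]
  exact he1 _ _

end sets

section fn
variable {X : Type u} [TopologicalSpace X]

/-- basic neighbourhood parameters -/
abbrev CP (X : Type u) [TopologicalSpace X] := {p : Set X × ℝ // IsCompact p.1 ∧ 0 < p.2}
/-- closeness -/
def RC (y : Ck X) (p : CP X) (f : Ck X) : Prop := ∀ x ∈ p.1.1, |f.1 x - y.1 x| < p.1.2
/-- admissible functions -/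
def GC (y : Ck X) (f : Ck X) : Prop := f ≠ y

lemma sepC (y : Ck X) : Sep (RC y) (GC y) := by
  intro f hf p
  have : ∃ x, f.1 x ≠ y.1 x := by
    by_contra h
    push Not at h
    exact hf (Subtype.ext (funext h))
  obtain ⟨x, hx⟩ := this
  refine ⟨⟨(insert x p.1.1, min p.1.2 |f.1 x - y.1 x|), p.2.1.insert x,
    lt_min p.2.2 (abs_pos.2 (sub_ne_zero.2 hx))⟩, fun h => ?_, fun g hg z hz => ?_⟩
  · have := h x (Set.mem_insert _ _)
    exact absurd (this.trans_le (min_le_right _ _)) (lt_irrefl _)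
  · exact (hg z (Set.mem_insert_of_mem _ hz)).trans_le (min_le_left _ _)

/-- to bundled maps -/
def toCM (f : Ck X) : C(X, ℝ) := ⟨f.1, f.2⟩

lemma toCM_inducing : IsInducing (toCM (X := X)) := by
  constructor
  rw [ContinuousMap.compactOpen_eq, induced_generateFrom_eq]
  show TopologicalSpace.generateFrom _ = _
  congr 1
  ext S
  constructor
  · rintro ⟨K, U, hK, hU, rfl⟩
    exact ⟨_, ⟨K, hK, U, hU, rfl⟩, rfl⟩
  · rintro ⟨_, ⟨K, hK, U, hU, rfl⟩, rfl⟩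
    exact ⟨K, U, hK, hU, rfl⟩

lemma nhds_basis (y : Ck X) : (𝓝 y).HasBasis (fun p : Set X × ℝ => IsCompact p.1 ∧ 0 < p.2)
    (fun p => {f | ∀ x ∈ p.1, |f.1 x - y.1 x| < p.2}) := by
  rw [toCM_inducing.nhds_eq_comap]
  have h := (nhds_basis_uniformity' (Metric.uniformity_basis_dist.compactConvergenceUniformity
    (α := X) (β := ℝ)) (x := toCM y)).comap (toCM (X := X))
  refine h.congr (fun _ => Iff.rfl) ?_
  intro p _
  ext f
  simp only [Set.mem_preimage, UniformSpace.ball, Set.mem_setOf_eq, dist_comm, Real.dist_eq]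
  constructor
  · intro h x hx
    rw [abs_sub_comm]; exact h x hx
  · intro h x hx
    have := h x hx
    rw [abs_sub_comm] at this; exact this

lemma Omega_eq (y : Ck X) : OmegaPt (Ck X) y = Cov (RC y) (GC y) := by
  ext A
  constructor
  · rintro ⟨h1, h2⟩
    refine ⟨fun a ha h => h2 (h ▸ ha), fun p => ?_⟩
    obtain ⟨f, hf, hA⟩ := (mem_closure_iff_nhds_basis (nhds_basis y)).1 h1 p.1 p.2
    exact ⟨f, hf, hA⟩
  · rintro ⟨h1, h2⟩
    refine ⟨(mem_closure_iff_nhds_basis (nhds_basis y)).2 fun p hp => ?_, fun h => h1 y h rfl⟩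
    obtain ⟨f, hf, h⟩ := h2 ⟨p, hp⟩
    exact ⟨f, hf, h⟩

/-- the k-cover attached to A -/
def covOf (y : Ck X) (n : ℕ) (A : Set (Ck X)) : Set (Set X) :=
  {V | GK V ∧ ∃ f ∈ A, ∀ x ∈ V, |f.1 x - y.1 x| < 1 / ((n : ℝ) + 1)}

lemma covOf_mem [T2Space X] (hX : ¬ CompactSpace X) (y : Ck X) (n : ℕ) {A : Set (Ck X)}
    (hA : A ∈ Cov (RC y) (GC y)) : covOf y n A ∈ Cov (RK (X := X)) GK := by
  refine ⟨fun a ha => ha.1, fun p => ?_⟩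
  obtain ⟨f, hf, hfp⟩ := hA.2 ⟨(p.1, 1 / ((n : ℝ) + 1)), p.2.1, by positivity⟩
  have : p.1 ≠ Set.univ := fun h => hX ⟨h ▸ p.2.1⟩
  obtain ⟨z, hz⟩ := (Set.ne_univ_iff_exists_notMem _).1 this
  have hsub : p.1 ⊆ {x | |f.1 x - y.1 x| < 1 / ((n : ℝ) + 1)} ∩ {z}ᶜ := fun x hx =>
    ⟨hfp x hx, fun h => hz (h ▸ hx)⟩
  refine ⟨{x | |f.1 x - y.1 x| < 1 / ((n : ℝ) + 1)} ∩ {z}ᶜ, ⟨⟨?_, p.2.2.mono hsub, ?_⟩, f, hf, fun x hx => hx.1⟩, hsub⟩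
  · exact (isOpen_lt ((f.2.sub y.2).abs) continuous_const).inter isOpen_compl_singleton
  · intro h
    have : z ∈ {x | |f.1 x - y.1 x| < 1 / ((n : ℝ) + 1)} ∩ {z}ᶜ := h ▸ Set.mem_univ z
    exact this.2 rfl

lemma nonemptyX (hX : ¬ CompactSpace X) : Nonempty X := by
  by_contra h
  rw [not_nonempty_iff] at h
  exact hX inferInstance

/-- enlarge to a nonempty compact -/
lemma exKP (hX : ¬ CompactSpace X) (p : CP X) : ∃ q : KP X, p.1.1 ⊆ q.1 := by
  obtain ⟨z⟩ := nonemptyX hX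
  exact ⟨⟨insert z p.1.1, p.2.1.insert z, Set.insert_nonempty _ _⟩, Set.subset_insert _ _⟩

lemma HpC [T2Space X] (hX : ¬ CompactSpace X) (hH : Hp (RK (X := X)) GK) (y : Ck X) :
    Hp (RC y) (GC y) := by
  intro A hA
  obtain ⟨F, hF, hFp⟩ := hH (fun n => covOf y n (A n)) (fun n => covOf_mem hX y n (hA n))
  have : ∀ n V, ∃ f : Ck X, V ∈ F n → f ∈ A n ∧ ∀ x ∈ V, |f.1 x - y.1 x| < 1 / ((n : ℝ) + 1) := by
    intro n V
    by_cases hV : V ∈ F n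
    · obtain ⟨f, hf⟩ := ((hF n).1 hV).2
      exact ⟨f, fun _ => hf⟩
    · exact ⟨y, fun h => absurd h hV⟩
  choose f hf using this
  refine ⟨fun n => f n '' F n, fun n => ⟨?_, (hF n).2.image _⟩, fun p => ?_⟩
  · rintro _ ⟨V, hV, rfl⟩
    exact (hf n V hV).1
  · obtain ⟨q, hq⟩ := exKP hX p
    have h0 : ∀ᶠ n : ℕ in atTop, 1 / ((n : ℝ) + 1) < p.1.2 :=
      tendsto_one_div_add_atTop_nhds_zero_nat.eventually (gt_mem_nhds p.2.2)
    filter_upwards [hFp q, h0] with n hn hn0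
    obtain ⟨V, hV, hqV⟩ := hn
    exact ⟨_, ⟨V, hV, rfl⟩, fun x hx => ((hf n V hV).2 x (hqV (hq hx))).trans hn0⟩

lemma SoneC [T2Space X] (hX : ¬ CompactSpace X)
    (hS : Sone (Cov (RK (X := X)) GK) (Cov RK GK)) (y : Ck X) :
    Sone (Cov (RC y) (GC y)) (Cov (RC y) (GC y)) := by
  intro A hA
  obtain ⟨V, hV, hVr⟩ := hS (fun n => covOf y n (A n)) (fun n => covOf_mem hX y n (hA n))
  choose hG f hf hfV using hV
  refine ⟨f, hf, ?_, fun p => ?_⟩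
  · rintro _ ⟨n, rfl⟩
    exact (hA n).1 _ (hf n)
  · obtain ⟨q, hq⟩ := exKP hX p
    have h0 : ∀ᶠ n : ℕ in atTop, 1 / ((n : ℝ) + 1) < p.1.2 :=
      tendsto_one_div_add_atTop_nhds_zero_nat.eventually (gt_mem_nhds p.2.2)
    obtain ⟨N, hN⟩ := eventually_atTop.1 h0
    have h1 := cov_diff sepK hVr ((Set.finite_lt_nat N).image V)
    obtain ⟨_, ⟨⟨n, rfl⟩, hn⟩, hqn⟩ := h1.2 q
    have hnN : N ≤ n := by
      by_contra h
      exact hn ⟨n, not_le.1 h, rfl⟩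
    exact ⟨_, ⟨n, rfl⟩, fun x hx => (hfV n x (hqn (hq hx))).trans (hN n hnN)⟩

lemma urysohn [T2Space X] [CompletelyRegularSpace X] {K U : Set X} (hK : IsCompact K)
    (hU : IsOpen U) (hKU : K ⊆ U) : ∃ f : Ck X, (∀ x ∈ K, f.1 x = 0) ∧ ∀ x ∉ U, f.1 x = 1 := by
  obtain ⟨O, hO, rfl⟩ := (isInducing_stoneCechUnit (X := X)).isOpen_iff.1 hU
  obtain ⟨f, h0, h1, -⟩ := exists_continuous_zero_one_of_isClosed
    (hK.image continuous_stoneCechUnit).isClosed hO.isClosed_compl (by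
      rw [Set.disjoint_compl_right_iff_subset]
      exact Set.image_subset_iff.2 hKU)
  exact ⟨⟨fun x => f (stoneCechUnit x), f.continuous.comp continuous_stoneCechUnit⟩,
    fun x hx => h0 ⟨x, hx, rfl⟩, fun x hx => h1 hx⟩

lemma WpK_of_WpC [T2Space X] [CompletelyRegularSpace X] (hX : ¬ CompactSpace X)
    (h : Wp (RC (zeroCk X)) (GC (zeroCk X))) : Wp (RK (X := X)) GK := by
  intro 𝒰 h𝒰
  obtain ⟨f, hf, N, h1, h2, h3⟩ := h (fun n => {f | ∃ U ∈ 𝒰 n, ∀ x ∉ U, f.1 x = 1}) (by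
    intro n
    refine ⟨?_, fun p => ?_⟩
    · rintro f ⟨U, hU, hfU⟩ rfl
      obtain ⟨x, hx⟩ := (Set.ne_univ_iff_exists_notMem _).1 ((h𝒰 n).1 U hU).2.2
      have := hfU x hx
      simp [zeroCk] at this
    · obtain ⟨q, hq⟩ := exKP hX p
      obtain ⟨U, hU, hqU⟩ := (h𝒰 n).2 q
      obtain ⟨f, hf0, hf1⟩ := urysohn q.2.1 ((h𝒰 n).1 U hU).1 hqU
      refine ⟨f, ⟨U, hU, hf1⟩, fun x hx => ?_⟩
      rw [hf0 x (hq hx)]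
      simpa [zeroCk] using p.2.2)
  choose U hU hfU using hf
  refine ⟨U, hU, N, h1, h2, fun p => ?_⟩
  filter_upwards [h3 ⟨(p.1, 1), p.2.1, one_pos⟩] with k hk
  obtain ⟨n, hn, hR⟩ := hk
  refine ⟨n, hn, fun x hx => ?_⟩
  by_contra hxU
  have := hR x hx
  rw [hfU n x hxU] at this
  simp [zeroCk] at this

end fn

end S17

theorem statement17 {X : Type u} [TopologicalSpace X] [T2Space X] [CompletelyRegularSpace X]
    (hX : ¬ CompactSpace X) :
    List.TFAE
      [Sone (KCovers X) (groupables (KCovers X)),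
       ¬ OneWinsGone (KCovers X) (groupables (KCovers X)),
       Reznichenko (Ck X) ∧ CountableStrongFanTightness (Ck X),
       Sone (OmegaPt (Ck X) (zeroCk X)) (groupables (OmegaPt (Ck X) (zeroCk X)))] := by
  rw [S17.KCovers_eq]
  tfae_have 1 → 2 := by
    intro h
    have hW := S17.Wp_of_Sone h
    exact S17.game (S17.Sone_of_Wp hW) (S17.HpK_of_Wp hW)
  tfae_have 2 → 1 := by
    intro h 𝒰 h𝒰
    by_contra hcon
    refine h ⟨fun s => 𝒰 s.length, fun s => h𝒰 _, fun f hf hr => hcon ⟨f, fun n => ?_, hr⟩⟩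
    simpa using hf n
  tfae_have 1 → 3 := by
    intro h
    have hW := S17.Wp_of_Sone h
    have hH := S17.HpK_of_Wp hW
    have hS := S17.Sone_of_Wp hW
    refine ⟨fun y A hA hc => ?_, fun y => ?_⟩
    · rw [S17.Omega_eq] at hA ⊢
      exact S17.groupable_of_Hp (S17.sepC y) (S17.HpC hX hH y) hA hc
    · rw [S17.Omega_eq]
      exact S17.SoneC hX hS y
  tfae_have 3 → 4 := by
    rintro ⟨hR, hS⟩ A hA
    obtain ⟨f, hf, hr⟩ := hS _ A hA
    exact ⟨f, hf, hr, hR _ _ hr (Set.countable_range f)⟩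
  tfae_have 4 → 1 := by
    intro h
    rw [S17.Omega_eq] at h
    have hW := S17.WpK_of_WpC hX (S17.Wp_of_Sone h)
    exact S17.Sone_gp S17.sepK (S17.HpK_of_Wp hW) (S17.Sone_of_Wp hW)
  tfae_finish
end
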